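/- Let f be a recurrent homeomorphism of a compact surface M with χ(M) = 0 (torus, Klein bottle, annulus, or Möbius strip). If f has a periodic point, then f is periodic. -/

import Mathlib

open Filter Topology Metric

/-- `f` is recurrent with respect to the metric `m`: some sequence of iterates
`f^[n k]` with `n k → ∞` converges uniformly to the identity. -/
def RecurrentWith {X : Type*} (m : MetricSpace X) (f : X → X) : Prop :=
  ∃ n : ℕ → ℕ, Filter.Tendsto n Filter.atTop Filter.atTop ∧
    ∀ ε > 0, ∀ᶠ k in Filter.atTop, ∀ x, @dist X m.toDist (f^[n k] x) x < ε

/-- `f` is a recurrent map of the metric space `X`. -/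
def IsRecurrent {X : Type*} [m : MetricSpace X] (f : X → X) : Prop :=
  RecurrentWith m f

/-- The 2-sphere. -/
abbrev Sphere2 : Set (EuclideanSpace ℝ (Fin 3)) := Metric.sphere 0 1

/-- The real projective plane: the quotient of the 2-sphere by the antipodal map. -/
abbrev ProjPlane := Quot (fun x y : Sphere2 => (y : EuclideanSpace ℝ (Fin 3)) = -(x : EuclideanSpace ℝ (Fin 3)))

/-- The 2-torus. -/
abbrev Torus2 := AddCircle (1 : ℝ) × AddCircle (1 : ℝ)

/-- The Klein bottle: quotient of the plane by the relations generating its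
fundamental group action. -/
abbrev KleinBottle := Quot (fun p q : ℝ × ℝ => q = (p.1 + 1, p.2) ∨ (q.1 = -p.1 ∧ q.2 = p.2 + 1))

/-- The closed annulus. -/
abbrev Annulus2 := AddCircle (1 : ℝ) × (Set.Icc (0 : ℝ) 1)

/-- The Moebius band: quotient of an infinite strip by a glide reflection. -/
abbrev MoebiusBand := Quot (fun p q : ℝ × (Set.Icc (-1 : ℝ) 1) => q.1 = p.1 + 1 ∧ (q.2 : ℝ) = -(p.2 : ℝ))


/-- continuous logarithms exist on simply connected spaces -/
theorem rz_exists_log {A : Type*} [TopologicalSpace A] [SimplyConnectedSpace A]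
    [LocallyPathConnectedSpace A] (g : A → ℂ) (hg : Continuous g) (h0 : ∀ z, g z ≠ 0)
    (a : A) (e : ℂ) (he : Complex.exp e = g a) :
    ∃ l : A → ℂ, Continuous l ∧ l a = e ∧ ∀ z, Complex.exp (l z) = g z := by
  obtain ⟨F, ⟨h1, h2⟩, -⟩ := IsCoveringMapOn.existsUnique_continuousMap_lifts
    Complex.isCoveringMapOn_exp (⟨g, hg⟩ : C(A, ℂ)) (a₀ := a) (e₀ := e) he (fun z => by simpa using h0 z)
  exact ⟨F, F.continuous, h1, fun z => congrFun h2 z⟩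

theorem rz_int_close {u : ℂ} (h : ∃ k : ℤ, u = k * (2 * Real.pi * Complex.I)) (hu : ‖u‖ < 2 * Real.pi) :
    u = 0 := by
  obtain ⟨k, rfl⟩ := h
  rcases eq_or_ne k 0 with rfl | hk
  · simp
  · exfalso
    have h1 : (1 : ℝ) ≤ |(k : ℝ)| := by exact_mod_cast Int.one_le_abs hk
    have h2 : ‖(k : ℂ) * (2 * Real.pi * Complex.I)‖ = |(k : ℝ)| * (2 * Real.pi) := by
      simp [abs_of_pos Real.pi_pos]
    rw [h2] at hu
    nlinarith [Real.pi_pos]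

theorem rz_log_diff {a b : ℂ} (h : Complex.exp a = Complex.exp b) :
    ∃ k : ℤ, a - b = k * (2 * Real.pi * Complex.I) := by
  obtain ⟨k, hk⟩ := Complex.exp_eq_exp_iff_exists_int.1 h
  exact ⟨k, by rw [hk]; ring⟩

theorem rz_int_sub {u v : ℂ} (h : ∃ k : ℤ, u = k * (2 * Real.pi * Complex.I))
    (h' : ∃ k : ℤ, v = k * (2 * Real.pi * Complex.I)) :
    ∃ k : ℤ, u - v = k * (2 * Real.pi * Complex.I) := by
  obtain ⟨k, rfl⟩ := h
  obtain ⟨j, rfl⟩ := h'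
  exact ⟨k - j, by push_cast; ring⟩

theorem rz_int_const {T : Type*} [TopologicalSpace T] {s : Set T} (hs : IsPreconnected s)
    {u : T → ℂ} (hu : ContinuousOn u s) (hi : ∀ x ∈ s, ∃ k : ℤ, u x = k * (2 * Real.pi * Complex.I))
    {x y : T} (hx : x ∈ s) (hy : y ∈ s) : u x = u y := by
  by_contra hne
  have hc : IsPreconnected (u '' s) := hs.image u hu
  obtain ⟨z, ⟨w, hw, rfl⟩, h1, h2⟩ := hc (ball (u x) 3) (closedBall (u x) 3)ᶜ isOpen_ball
    isClosed_closedBall.isOpen_compl (by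
      rintro _ ⟨w, hw, rfl⟩
      by_cases h : u w = u x
      · left; rw [h]; simp
      · right
        simp only [Set.mem_compl_iff, mem_closedBall, not_le]
        by_contra h3
        push Not at h3
        rw [dist_eq_norm] at h3
        exact h (sub_eq_zero.1 (rz_int_close (rz_int_sub (hi w hw) (hi x hx))
          (by nlinarith [Real.pi_gt_three]))))
    ⟨u x, ⟨x, hx, rfl⟩, by simp⟩ ⟨u y, ⟨y, hy, rfl⟩, by
        simp only [Set.mem_compl_iff, mem_closedBall, not_le]
        by_contra h3
        push Not at h3
        rw [dist_eq_norm] at h3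
        exact hne (sub_eq_zero.1 (rz_int_close (rz_int_sub (hi y hy) (hi x hx))
          (by nlinarith [Real.pi_gt_three]))).symm⟩
  exact h2 (ball_subset_closedBall h1)

theorem rz_log_unique {T : Type*} [TopologicalSpace T] {s : Set T} (hs : IsPreconnected s)
    {l m : T → ℂ} (hl : ContinuousOn l s) (hm : ContinuousOn m s)
    (he : ∀ x ∈ s, Complex.exp (l x) = Complex.exp (m x))
    {x y : T} (hx : x ∈ s) (hy : y ∈ s) (hxe : l x = m x) : l y = m y := by
  have := rz_int_const hs (hl.sub hm) (fun x hx => rz_log_diff (he x hx)) hx hy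
  simp only [Pi.sub_apply] at this
  rw [hxe, sub_self] at this
  exact (sub_eq_zero.1 this.symm)

theorem rz_no_log_circle {R : ℝ} (hR : 0 < R) (l : ℂ → ℂ) (hl : ContinuousOn l (sphere 0 R))
    (he : ∀ w ∈ sphere (0 : ℂ) R, Complex.exp (l w) = w) : False := by
  have hmem : ∀ t : ℝ, (R : ℂ) * Complex.exp (t * Complex.I) ∈ sphere (0 : ℂ) R := by
    intro t
    simp [Complex.norm_exp_ofReal_mul_I, abs_of_pos hR]
  have h1 : Continuous fun t : ℝ => l ((R : ℂ) * Complex.exp (t * Complex.I)) := by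
    apply hl.comp_continuous (by fun_prop) hmem
  have h2 : Continuous fun t : ℝ => ((Real.log R : ℂ) + t * Complex.I) := by fun_prop
  have := rz_int_const (u := fun t : ℝ => l ((R : ℂ) * Complex.exp (t * Complex.I)) -
      ((Real.log R : ℂ) + t * Complex.I)) isPreconnected_univ (h1.sub h2).continuousOn
    (fun t _ => rz_log_diff (by
      rw [he _ (hmem t), Complex.exp_add, ← Complex.ofReal_exp, Real.exp_log hR]))
    (Set.mem_univ 0) (Set.mem_univ (2 * Real.pi))
  simp only [Complex.ofReal_zero, zero_mul, Complex.exp_zero, Complex.ofReal_mul,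
    Complex.ofReal_ofNat, Complex.exp_two_pi_mul_I] at this
  have h3 : (2 * Real.pi * Complex.I : ℂ) = 0 := by linear_combination this
  exact Complex.two_pi_I_ne_zero h3

theorem rz_slit {z : ℂ} (h : ‖z - 1‖ < 1) : z ∈ Complex.slitPlane := by
  apply Complex.mem_slitPlane_of_norm_lt_one (z := z - 1) h |> fun h => by simpa using h

/-- maps of the plane with bounded displacement are onto -/
theorem rz_surj {g : ℂ → ℂ} (hg : Continuous g) {C : ℝ} (hb : ∀ z, ‖g z - z‖ ≤ C) :
    Function.Surjective g := by
  intro y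
  by_contra hy
  push Not at hy
  have h0 : ∀ z, g z - y ≠ 0 := fun z => sub_ne_zero.2 (hy z)
  obtain ⟨l, hl, -, hle⟩ := rz_exists_log (fun z => g z - y) (by fun_prop) h0 0
    (Complex.log (g 0 - y)) (Complex.exp_log (h0 0))
  have hC : 0 ≤ C := (norm_nonneg _).trans (hb 0)
  have hR : 0 < C + ‖y‖ + 1 := by positivity
  have hw0 : ∀ w ∈ sphere (0 : ℂ) (C + ‖y‖ + 1), w ≠ 0 := by
    rintro w hw rfl
    simp at hw
    linarith
  have hs : ∀ w ∈ sphere (0 : ℂ) (C + ‖y‖ + 1), (g w - y) / w ∈ Complex.slitPlane := by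
    intro w hw
    apply rz_slit
    have h := hw0 w hw
    rw [div_sub_one h, norm_div, div_lt_one (norm_pos_iff.2 h)]
    rw [mem_sphere_zero_iff_norm] at hw
    calc ‖g w - y - w‖ = ‖(g w - w) - y‖ := by ring_nf
      _ ≤ ‖g w - w‖ + ‖y‖ := norm_sub_le _ _
      _ < ‖w‖ := by have := hb w; linarith
  refine rz_no_log_circle hR (fun w => l w - Complex.log ((g w - y) / w)) ?_ ?_
  · apply hl.continuousOn.sub
    apply ContinuousOn.clog _ hs
    exact (hg.sub continuous_const).continuousOn.div continuousOn_id hw0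
  · intro w hw
    have h := hw0 w hw
    rw [Complex.exp_sub, hle, Complex.exp_log (div_ne_zero (h0 w) h)]
    field_simp [h0 w]

/-- closed set whose union with infinity is connected -/
def RzNC (X : Set ℂ) : Prop := ∀ O : Set ℂ, IsOpen O → IsCompact (X ∩ O) → X ∩ O = ∅

theorem rz_NC_zero {X : Set ℂ} (hX : IsClosed X) (hn : RzNC X) {u : ℂ → ℂ} (hu : ContinuousOn u X)
    (hi : ∀ x ∈ X, ∃ k : ℤ, u x = k * (2 * Real.pi * Complex.I))
    {R : ℝ} (hR : ∀ x ∈ X, R < ‖x‖ → u x = 0) {x : ℂ} (hx : x ∈ X) : u x = 0 := by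
  obtain ⟨O, hO, hO2⟩ := continuousOn_iff'.1 hu ({0}ᶜ) isClosed_singleton.isOpen_compl
  have h1 : X ∩ O = X ∩ u ⁻¹' {0}ᶜ := by rw [Set.inter_comm X O, ← hO2, Set.inter_comm]
  have h2 : X ∩ u ⁻¹' {0}ᶜ = X ∩ u ⁻¹' (ball 0 3)ᶜ := by
    ext y
    simp only [Set.mem_inter_iff, Set.mem_preimage, Set.mem_compl_iff, Set.mem_singleton_iff,
      mem_ball_zero_iff, not_lt]
    constructor
    · rintro ⟨hy, h⟩
      refine ⟨hy, ?_⟩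
      by_contra h3
      exact h (rz_int_close (hi y hy) (by nlinarith [Real.pi_gt_three]))
    · rintro ⟨hy, h⟩
      refine ⟨hy, fun h' => ?_⟩
      rw [h'] at h
      simp at h
      linarith
  have h3 : IsCompact (X ∩ O) := by
    rw [h1]
    apply (isCompact_closedBall (0 : ℂ) R).of_isClosed_subset
    · rw [h2]
      exact hu.preimage_isClosed_of_isClosed hX isOpen_ball.isClosed_compl
    · rintro y ⟨hy, h⟩
      rw [mem_closedBall_zero_iff]
      by_contra h4
      push Not at h4
      exact h (hR y hy h4)
  have h4 := hn O hO h3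
  by_contra h5
  rw [h1] at h4
  exact (Set.eq_empty_iff_forall_notMem.1 h4 x) ⟨hx, h5⟩


theorem rz_comp_sep {S : Type*} [TopologicalSpace S] [CompactSpace S] [T2Space S] {D A : Set S}
    (hD : IsClosed D) {p : S} (hp : p ∈ D) (hA : IsClosed A)
    (hd : ∀ x ∈ connectedComponentIn D p, x ∉ A) :
    ∃ P ⊆ D, p ∈ P ∧ IsClosed P ∧ IsClosed (D \ P) ∧ ∀ x ∈ P, x ∉ A := by
  have : CompactSpace D := isCompact_iff_compactSpace.1 hD.isCompact
  rw [connectedComponentIn_eq_image hp, ] at hd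
  have : Nonempty { s : Set D // IsClopen s ∧ (⟨p, hp⟩ : D) ∈ s } := ⟨⟨Set.univ, isClopen_univ, trivial⟩⟩
  obtain ⟨⟨P, hP1, hP2⟩, hP3⟩ := exists_subset_nhds_of_compactSpace
    (V := fun s : { s : Set D // IsClopen s ∧ (⟨p, hp⟩ : D) ∈ s } => (s : Set D))
    (U := Subtype.val ⁻¹' Aᶜ)
    (by
      rintro ⟨s, hs, hs'⟩ ⟨t, ht, ht'⟩
      exact ⟨⟨s ∩ t, hs.inter ht, hs', ht'⟩, Set.inter_subset_left, Set.inter_subset_right⟩)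
    (fun s => s.2.1.isClosed)
    (by
      rw [← connectedComponent_eq_iInter_isClopen]
      intro x hx
      apply (hA.isOpen_compl.preimage continuous_subtype_val).mem_nhds
      exact hd _ ⟨x, hx, rfl⟩)
  refine ⟨Subtype.val '' P, by simp, ⟨_, hP2, rfl⟩, ?_, ?_, ?_⟩
  · exact hD.isClosedEmbedding_subtypeVal.isClosedMap _ hP1.isClosed
  · have : D \ (Subtype.val '' P) = Subtype.val '' Pᶜ := by
      ext x
      constructor
      · rintro ⟨h1, h2⟩
        exact ⟨⟨x, h1⟩, fun h => h2 ⟨_, h, rfl⟩, rfl⟩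
      · rintro ⟨y, h1, rfl⟩
        refine ⟨y.2, ?_⟩
        rintro ⟨z, hz, h⟩
        exact h1 (Subtype.ext h ▸ hz)
    rw [this]
    exact hD.isClosedEmbedding_subtypeVal.isClosedMap _ hP1.compl.isClosed
  · rintro _ ⟨y, hy, rfl⟩
    exact hP3 hy

theorem rz_growth_abstract {S : Type*} [TopologicalSpace S] [CompactSpace S] [T2Space S]
    [PreconnectedSpace S] (T : S ≃ₜ S) (p : S) (hp : T p = p) (N : Set S) (hN : IsOpen N)
    (hNe : N.Nonempty) (hpN : p ∉ N)
    (hrec : ∀ W : Set S, IsOpen W → closure N ⊆ W → ∀ m : ℕ, ∃ M : ℕ, m ≤ M ∧ ∀ x ∈ closure N,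
      (T ^ (M : ℤ)) x ∈ W ∧ (T ^ (-(M : ℤ))) x ∈ W) :
    ∃ Q : Set S, IsClosed Q ∧ IsPreconnected Q ∧ p ∈ Q ∧ (∀ x, T x ∈ Q ↔ x ∈ Q) ∧
      (∀ x ∈ Q, x ∉ N) ∧ ∃ x ∈ Q, x ∈ closure N := by
  have hpz : ∀ j : ℤ, (T ^ j) p = p := by
    have h1 : ∀ j : ℕ, (T ^ j) p = p := by
      intro j
      induction j with
      | zero => simp
      | succ j ih => rw [pow_succ, Homeomorph.mul_apply, hp, ih]
    intro j
    obtain ⟨n, rfl | rfl⟩ := j.eq_nat_or_neg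
    · simpa using h1 n
    · rw [zpow_neg, Homeomorph.inv_apply, Homeomorph.symm_apply_eq]
      simpa using (h1 n).symm
  have hzadd : ∀ (i j : ℤ) x, (T ^ i) ((T ^ j) x) = (T ^ (i + j)) x := by
    intro i j x
    rw [zpow_add, Homeomorph.mul_apply]
  have hclJ : ∀ J : Set ℤ, IsClosed {x | ∀ j ∈ J, (T ^ j) x ∉ N} := by
    intro J
    have : {x | ∀ j ∈ J, (T ^ j) x ∉ N} = ⋂ j ∈ J, (T ^ j) ⁻¹' Nᶜ := by ext; simp
    rw [this]
    exact isClosed_biInter fun j _ => hN.isClosed_compl.preimage (T ^ j).continuous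
  set E : Set S := {x | ∀ j : ℤ, (T ^ j) x ∉ N} with hE
  have hEc : IsClosed E := by simpa using hclJ Set.univ
  have hpE : p ∈ E := fun j => by rw [hpz]; exact hpN
  have hCc : IsClosed (connectedComponentIn E p) := by
    apply isClosed_of_closure_subset
    exact (isPreconnected_connectedComponentIn.closure).subset_connectedComponentIn
      (subset_closure (mem_connectedComponentIn hpE))
      (closure_minimal (connectedComponentIn_subset _ _) hEc)
  refine ⟨connectedComponentIn E p, hCc, isPreconnected_connectedComponentIn,
    mem_connectedComponentIn hpE, ?_, ?_, ?_⟩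
  · have hTE : T '' E = E := by
      ext x
      constructor
      · rintro ⟨y, hy, rfl⟩ j
        have := hy (j + 1)
        rwa [zpow_add_one] at this
      · intro hx
        refine ⟨T.symm x, fun j => ?_, by simp⟩
        have := hx (j - 1)
        rwa [zpow_sub_one] at this
    have h := T.image_connectedComponentIn hpE
    rw [hTE, hp] at h
    intro x
    constructor
    · intro hx
      rw [← h] at hx
      obtain ⟨y, hy, hyx⟩ := hx
      rwa [← T.injective hyx]
    · intro hx
      rw [← h]
      exact ⟨x, hx, rfl⟩
  · intro x hx
    have := connectedComponentIn_subset _ _ hx 0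
    simpa using this
  · by_contra hcon
    push Not at hcon
    obtain ⟨P, hPE, hpP, hPc, hPc', hPN⟩ := rz_comp_sep hEc hpE (isClosed_closure (s := N)) hcon
    obtain ⟨O1, O2, hO1, hO2, h1, h2, h12⟩ := normal_separation hPc hPc' Set.disjoint_sdiff_right
    obtain ⟨G, W, hG, hW, h3, h4, hGW⟩ := normal_separation hPc (isClosed_closure (s := N))
      (Set.disjoint_left.2 hPN)
    obtain ⟨m, hm⟩ : ∃ m : ℕ, {x | ∀ j ∈ {j : ℤ | |j| ≤ m}, (T ^ j) x ∉ N} ⊆ (O1 ∩ G) ∪ O2 := by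
      apply exists_subset_nhds_of_compactSpace
        (V := fun m : ℕ => {x | ∀ j ∈ {j : ℤ | |j| ≤ m}, (T ^ j) x ∉ N})
      · refine Antitone.directed_ge ?_
        intro a b hab x hx j hj
        apply hx
        have : (a : ℤ) ≤ b := by exact_mod_cast hab
        exact le_trans hj this
      · exact fun m => hclJ _
      · intro x hx
        apply (((hO1.inter hG).union hO2)).mem_nhds
        have hxE : x ∈ E := by
          intro j
          have := Set.mem_iInter.1 hx j.natAbs
          exact this j (by simp)
        by_cases hxP : x ∈ P
        · exact Or.inl ⟨h1 hxP, h3 hxP⟩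
        · exact Or.inr (h2 ⟨hxE, hxP⟩)
    have key : ∀ L : Set S, IsPreconnected L → p ∈ L → (∀ x ∈ L, ∀ j : ℤ, |j| ≤ m → (T ^ j) x ∉ N) →
        ∀ x ∈ L, x ∉ W := by
      intro L hL hpL hLm x hx hxW
      have := hL.subset_left_of_subset_union (hO1.inter hG) hO2
        (h12.mono_left Set.inter_subset_left) (fun y hy => hm (hLm y hy)) ⟨p, hpL, h1 hpP, h3 hpP⟩
      exact Set.disjoint_left.1 hGW (this hx).2 hxW
    obtain ⟨M, hmM, hM⟩ := hrec W hW h4 m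
    set n : ℤ := 2 * m + M with hn
    -- boundary bumping
    set D : Set S := {x | ∀ j ∈ Set.Icc (0 : ℤ) n, (T ^ j) x ∉ N} with hD
    have hpD : p ∈ D := fun j _ => hpE j
    obtain ⟨i, hi, x, hxK, hxN⟩ : ∃ i ∈ Set.Icc (0 : ℤ) n, ∃ x ∈ connectedComponentIn D p,
        (T ^ i) x ∈ closure N := by
      by_contra hno
      push Not at hno
      have hAc : IsClosed (⋃ i ∈ Set.Icc (0 : ℤ) n, (T ^ i) ⁻¹' closure N) := by
        apply (Set.finite_Icc _ _).isClosed_biUnion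
        exact fun i _ => isClosed_closure.preimage (T ^ i).continuous
      obtain ⟨P', hPD, hpP', hPc1, hPc2, hPA⟩ := rz_comp_sep (hclJ (Set.Icc (0 : ℤ) n)) hpD hAc (by
        intro x hx hxA
        simp only [Set.mem_iUnion, Set.mem_preimage] at hxA
        obtain ⟨i, hi, h⟩ := hxA
        exact hno i hi x hx h)
      have hop : IsOpen P' := by
        have : P' = (⋃ i ∈ Set.Icc (0 : ℤ) n, (T ^ i) ⁻¹' closure N)ᶜ ∩ (D \ P')ᶜ := by
          ext y
          constructor
          · intro hy
            exact ⟨hPA y hy, fun h => h.2 hy⟩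
          · rintro ⟨hy1, hy2⟩
            by_contra hy
            apply hy2
            refine ⟨fun j hj hjN => hy1 ?_, hy⟩
            simp only [Set.mem_iUnion, Set.mem_preimage]
            exact ⟨j, hj, subset_closure hjN⟩
        rw [this]
        exact hAc.isOpen_compl.inter hPc2.isOpen_compl
      have huniv := IsClopen.eq_univ ⟨hPc1, hop⟩ ⟨p, hpP'⟩
      obtain ⟨y, hy⟩ := hNe
      have hyP : y ∈ P' := huniv ▸ Set.mem_univ y
      apply hPD hyP 0 ⟨le_refl _, by positivity⟩
      simpa using hy
    have hKD : ∀ y ∈ connectedComponentIn D p, ∀ j : ℤ, 0 ≤ j → j ≤ n → (T ^ j) y ∉ N :=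
      fun y hy j h0 h1 => connectedComponentIn_subset _ _ hy j ⟨h0, h1⟩
    have hmove : ∀ k : ℤ, (∀ j : ℤ, |j| ≤ m → 0 ≤ j + k ∧ j + k ≤ n) → (T ^ k) x ∉ W := by
      intro k hk
      refine key ((T ^ k) '' connectedComponentIn D p)
        (isPreconnected_connectedComponentIn.image _ (T ^ k).continuous.continuousOn)
        ⟨p, mem_connectedComponentIn hpD, hpz k⟩ ?_ _ ⟨x, hxK, rfl⟩
      rintro _ ⟨y, hy, rfl⟩ j hj
      rw [hzadd]
      exact hKD y hy _ (hk j hj).1 (hk j hj).2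
    obtain ⟨hi0, hin⟩ := hi
    have hmM' : (m : ℤ) ≤ M := by exact_mod_cast hmM
    have hM' := hM _ hxN
    rw [hzadd, hzadd] at hM'
    by_cases c1 : i < m
    · exact hmove (M + i) (fun j hj => by rw [abs_le] at hj; omega) hM'.1
    · by_cases c2 : n - i < m
      · exact hmove (-M + i) (fun j hj => by rw [abs_le] at hj; omega) hM'.2
      · exact hmove i (fun j hj => by rw [abs_le] at hj; omega) (h4 hxN)

theorem rz_growth (F : ℂ ≃ₜ ℂ)
    (hr : ∀ ε > 0, ∀ m : ℕ, ∃ n ≥ m, ∀ z, ‖F^[n] z - z‖ < ε)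
    {N : Set ℂ} (hN : IsOpen N) (hNe : N.Nonempty) (hNb : Bornology.IsBounded N) :
    ∃ X : Set ℂ, IsClosed X ∧ RzNC X ∧ (∀ w, F w ∈ X ↔ w ∈ X) ∧ (∀ x ∈ X, x ∉ N) ∧
      ∃ x ∈ X, x ∈ closure N := by
  set T := F.onePointCongr with hT
  have hTc : ∀ z : ℂ, T (z : OnePoint ℂ) = (F z : OnePoint ℂ) := fun z => rfl
  have hTn : ∀ (n : ℕ) (z : ℂ), (T ^ (n : ℤ)) (z : OnePoint ℂ) = (F^[n] z : ℂ) := by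
    intro n
    induction n with
    | zero => simp
    | succ n ih =>
      intro z
      rw [Nat.cast_succ, zpow_add_one, Homeomorph.mul_apply, hTc, ih, Function.iterate_succ_apply]
  have hcomp : IsCompact (closure N) := hNb.isCompact_closure
  have hcl : closure ((↑) '' N : Set (OnePoint ℂ)) ⊆ (↑) '' closure N := by
    apply closure_minimal (Set.image_mono subset_closure)
    exact OnePoint.isClosed_image_coe.2 ⟨isClosed_closure, hcomp⟩
  have hcl' : ((↑) '' closure N : Set (OnePoint ℂ)) ⊆ closure ((↑) '' N : Set (OnePoint ℂ)) :=
    image_closure_subset_closure_image OnePoint.continuous_coe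
  obtain ⟨Q, hQc, hQp, hpQ, hQi, hQN, y, hyQ, hy⟩ := rz_growth_abstract T OnePoint.infty rfl ((↑) '' N)
    (OnePoint.isOpen_image_coe.2 hN) (hNe.image _) (by simp) (by
      intro W hW hNW m
      obtain ⟨δ, hδ, hδW⟩ := hcomp.exists_thickening_subset_open
        (hW.preimage OnePoint.continuous_coe) (fun z hz => hNW (hcl' ⟨z, hz, rfl⟩))
      obtain ⟨n, hnm, hn⟩ := hr δ hδ m
      refine ⟨n, hnm, ?_⟩
      intro x hx
      obtain ⟨z, hz, rfl⟩ := hcl hx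
      constructor
      · rw [hTn]
        exact hδW (mem_thickening_iff.2 ⟨z, hz, by rw [dist_eq_norm]; exact hn z⟩)
      · obtain ⟨w, rfl⟩ := (F.surjective.iterate n) z
        rw [← hTn, zpow_neg, Homeomorph.inv_apply, Homeomorph.symm_apply_apply]
        exact hδW (mem_thickening_iff.2 ⟨_, hz, by rw [dist_comm, dist_eq_norm]; exact hn w⟩))
  refine ⟨((↑) : ℂ → OnePoint ℂ) ⁻¹' Q, hQc.preimage OnePoint.continuous_coe, ?_, fun w => hQi w, ?_, ?_⟩
  · intro O hO hc
    by_contra hne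
    obtain ⟨w, hw1, hw2⟩ := Set.nonempty_iff_ne_empty.2 hne
    have hcc : IsClosed ((↑) '' ((↑) ⁻¹' Q ∩ O) : Set (OnePoint ℂ)) :=
      OnePoint.isClosed_image_coe.2 ⟨hc.isClosed, hc⟩
    obtain ⟨v, hv1, ⟨u, hu, rfl⟩, hv3⟩ := hQp ((↑) '' O) ((↑) '' ((↑) ⁻¹' Q ∩ O) : Set (OnePoint ℂ))ᶜ
      (OnePoint.isOpen_image_coe.2 hO) hcc.isOpen_compl (by
        intro v hv
        by_cases h : v ∈ ((↑) '' O : Set (OnePoint ℂ))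
        · exact Or.inl h
        · refine Or.inr fun h' => h ?_
          exact Set.image_mono Set.inter_subset_right h')
      ⟨w, hw1, w, hw2, rfl⟩ ⟨OnePoint.infty, hpQ, by simp⟩
    exact hv3 ⟨u, ⟨hv1, hu⟩, rfl⟩
  · intro x hx hxN
    exact hQN _ hx ⟨x, hxN, rfl⟩
  · obtain ⟨z, hz, rfl⟩ := hcl hy
    exact ⟨z, hyQ, hz⟩


theorem rz_bump (c v : ℂ) (R : ℝ) (hv : ‖v‖ < R) :
    ∃ ρ : ℂ ≃ₜ ℂ, ∀ w, ρ w = w + ((max 0 (1 - ‖w - c‖ / R) : ℝ) : ℂ) * v := by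
  have hR : 0 < R := (norm_nonneg v).trans_lt hv
  obtain ⟨k, hk⟩ : ∃ k : NNReal, (k : ℝ) = ‖v‖ / R := ⟨⟨‖v‖ / R, by positivity⟩, rfl⟩
  have hlip : ApproximatesLinearOn (fun w : ℂ => w + ((max 0 (1 - ‖w - c‖ / R) : ℝ) : ℂ) * v)
      ((ContinuousLinearEquiv.refl ℝ ℂ : ℂ ≃L[ℝ] ℂ) : ℂ →L[ℝ] ℂ) Set.univ
      k := by
    intro x _ y _
    simp only [ContinuousLinearEquiv.coe_refl, ContinuousLinearMap.coe_id', id_eq]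
    have h1 : x + ((max 0 (1 - ‖x - c‖ / R) : ℝ) : ℂ) * v - (y + ((max 0 (1 - ‖y - c‖ / R) : ℝ) : ℂ) * v)
        - (x - y) = (((max 0 (1 - ‖x - c‖ / R)) - (max 0 (1 - ‖y - c‖ / R)) : ℝ) : ℂ) * v := by
      push_cast; ring
    rw [h1, norm_mul, Complex.norm_real, Real.norm_eq_abs]
    have h2 : |max 0 (1 - ‖x - c‖ / R) - max 0 (1 - ‖y - c‖ / R)| ≤
        |(1 - ‖x - c‖ / R) - (1 - ‖y - c‖ / R)| := by
      have := abs_max_sub_max_le_abs (1 - ‖x - c‖ / R) (1 - ‖y - c‖ / R) 0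
      rwa [max_comm _ (0:ℝ), max_comm _ (0:ℝ)] at this
    have h3 : |(1 - ‖x - c‖ / R) - (1 - ‖y - c‖ / R)| ≤ ‖x - y‖ / R := by
      rw [show (1 - ‖x - c‖ / R) - (1 - ‖y - c‖ / R) = (‖y - c‖ - ‖x - c‖) / R by ring, abs_div,
        abs_of_pos hR]
      gcongr
      have := abs_norm_sub_norm_le (y - c) (x - c)
      rwa [sub_sub_sub_cancel_right, norm_sub_rev y x] at this
    calc _ ≤ ‖x - y‖ / R * ‖v‖ := by gcongr; exact h2.trans h3
      _ = _ := by rw [hk]; ring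
  have hc : Subsingleton ℂ ∨ k <
      ‖(((ContinuousLinearEquiv.refl ℝ ℂ : ℂ ≃L[ℝ] ℂ).symm : ℂ ≃L[ℝ] ℂ) : ℂ →L[ℝ] ℂ)‖₊⁻¹ := by
    right
    have : ‖(((ContinuousLinearEquiv.refl ℝ ℂ : ℂ ≃L[ℝ] ℂ).symm : ℂ ≃L[ℝ] ℂ) : ℂ →L[ℝ] ℂ)‖₊ = 1 := by
      have := ContinuousLinearMap.nnnorm_id (𝕜 := ℝ) (E := ℂ)
      exact this
    rw [this, inv_one, ← NNReal.coe_lt_coe]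
    rw [NNReal.coe_one, hk]
    rwa [div_lt_one hR]
  exact ⟨hlip.toHomeomorph _ hc, fun w => rfl⟩

/-- homeomorphisms supported in a compact subset -/
def RzSupp (φ : ℂ ≃ₜ ℂ) (V : Set ℂ) : Prop := ∃ K ⊆ V, IsCompact K ∧ ∀ w, w ∉ K → φ w = w

theorem RzSupp.mono {φ : ℂ ≃ₜ ℂ} {V V' : Set ℂ} (h : RzSupp φ V) (hV : V ⊆ V') : RzSupp φ V' := by
  obtain ⟨K, h1, h2, h3⟩ := h
  exact ⟨K, h1.trans hV, h2, h3⟩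

theorem RzSupp.mem_iff {φ : ℂ ≃ₜ ℂ} {V : Set ℂ} (h : RzSupp φ V) {w : ℂ} : φ w ∈ V ↔ w ∈ V := by
  obtain ⟨K, h1, h2, h3⟩ := h
  constructor
  · intro h4
    by_contra h5
    rw [h3 w (fun h => h5 (h1 h))] at h4
    exact h5 h4
  · intro h4
    by_contra h5
    have := φ.injective (h3 (φ w) (fun h => h5 (h1 h)))
    rw [this] at h5
    exact h5 h4

theorem RzSupp.eq {φ : ℂ ≃ₜ ℂ} {V : Set ℂ} (h : RzSupp φ V) {w : ℂ} (hw : w ∉ V) : φ w = w := by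
  obtain ⟨K, h1, h2, h3⟩ := h
  exact h3 w (fun h => hw (h1 h))

theorem RzSupp.bounded {φ : ℂ ≃ₜ ℂ} {V : Set ℂ} (h : RzSupp φ V) : ∃ C, ∀ w, ‖φ w - w‖ ≤ C := by
  obtain ⟨K, h1, h2, h3⟩ := h
  obtain ⟨C, hC⟩ := h2.exists_bound_of_continuousOn (f := fun w => φ w - w) (by fun_prop)
  refine ⟨max C 0, fun w => ?_⟩
  by_cases hw : w ∈ K
  · exact (hC w hw).trans (le_max_left _ _)
  · rw [h3 w hw]; simp

theorem rz_bump_supp {ρ : ℂ ≃ₜ ℂ} {c v : ℂ} {R : ℝ} (hR : 0 < R)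
    (hρ : ∀ w, ρ w = w + ((max 0 (1 - ‖w - c‖ / R) : ℝ) : ℂ) * v) {V : Set ℂ}
    (hV : closedBall c R ⊆ V) : RzSupp ρ V := by
  refine ⟨closedBall c R, hV, isCompact_closedBall _ _, fun w hw => ?_⟩
  rw [hρ, max_eq_left]
  · simp
  · simp only [mem_closedBall, not_le, dist_eq_norm] at hw
    rw [sub_nonpos, one_le_div hR]
    exact hw.le

theorem rz_homog {V : Set ℂ} (hV : IsOpen V) (hc : IsPreconnected V) {a b : ℂ} (ha : a ∈ V) (hb : b ∈ V) :
    ∃ φ : ℂ ≃ₜ ℂ, RzSupp φ V ∧ φ a = b := by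
  refine hc.induction₂ (fun a b => ∃ φ : ℂ ≃ₜ ℂ, RzSupp φ V ∧ φ a = b) ?_ ?_ ?_ ha hb
  · intro x hx
    obtain ⟨R, hR, hRV⟩ := nhds_basis_closedBall.mem_iff.1 (hV.mem_nhds hx)
    filter_upwards [mem_nhdsWithin_of_mem_nhds (ball_mem_nhds x hR)] with y hy
    rw [mem_ball, dist_eq_norm] at hy
    obtain ⟨ρ, hρ⟩ := rz_bump x (y - x) R hy
    refine ⟨ρ, rz_bump_supp hR hρ hRV, ?_⟩
    rw [hρ]; simp
  · rintro x y z _ _ _ ⟨φ, ⟨K, h1, h2, h3⟩, h⟩ ⟨ψ, ⟨L, g1, g2, g3⟩, g⟩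
    refine ⟨φ.trans ψ, ⟨K ∪ L, Set.union_subset h1 g1, h2.union g2, fun w hw => ?_⟩, by simp [h, g]⟩
    simp only [Set.mem_union, not_or] at hw
    simp [h3 w hw.1, g3 w hw.2]
  · rintro x y _ _ ⟨φ, ⟨K, h1, h2, h3⟩, h⟩
    refine ⟨φ.symm, ⟨K, h1, h2, fun w hw => ?_⟩, by simp [← h]⟩
    rw [Homeomorph.symm_apply_eq, h3 w hw]

theorem rz_push {a b R : ℝ} (hab : a ≤ b) (hbR : b - a < R) (haR : |a| + R < 1) :
    ∃ ρ : ℂ ≃ₜ ℂ, RzSupp ρ (ball 0 1) ∧ ρ a = b ∧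
      (∀ t : ℝ, a < t → t < 1 → ∃ t' : ℝ, b < t' ∧ t' < 1 ∧ ρ t = t') ∧
      (∀ w : ℂ, ∀ t' : ℝ, b ≤ t' → t' < 1 → ρ w = t' → ∃ t : ℝ, a ≤ t ∧ t < 1 ∧ w = t) := by
  have hR : 0 < R := by linarith
  obtain ⟨ρ, hρ⟩ := rz_bump (a : ℂ) ((b - a : ℝ) : ℂ) R (by
    rw [Complex.norm_real, Real.norm_eq_abs, abs_of_nonneg (by linarith)]; exact hbR)
  have ha1 : a + R < 1 := by linarith [le_abs_self a]
  set r : ℝ → ℝ := fun t => t + max 0 (1 - |t - a| / R) * (b - a) with hr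
  have hρr : ∀ t : ℝ, ρ t = (r t : ℝ) := by
    intro t
    rw [hρ, hr, ← Complex.ofReal_sub t a, Complex.norm_real, Real.norm_eq_abs]
    push_cast; ring
  have hra : r a = b := by simp [hr]
  have hr1 : r 1 = 1 := by
    have : max 0 (1 - |1 - a| / R) = 0 := by
      apply max_eq_left
      rw [sub_nonpos, one_le_div hR]
      linarith [le_abs_self (1 - a)]
    simp only [hr, this]; ring
  have hmono : ∀ s t : ℝ, a ≤ s → s < t → r s < r t := by
    intro s t has hst
    have h1 : max 0 (1 - |s - a| / R) - max 0 (1 - |t - a| / R) ≤ (t - s) / R := by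
      rw [abs_of_nonneg (by linarith), abs_of_nonneg (by linarith)]
      rw [sub_le_iff_le_add]
      apply max_le
      · have : 0 ≤ (t - s) / R := div_nonneg (by linarith) hR.le
        linarith [le_max_left 0 (1 - (t - a) / R)]
      · have := le_max_right 0 (1 - (t - a) / R)
        have e : (t - s) / R = (t - a) / R - (s - a) / R := by ring
        rw [e]; linarith
    have h2 : (max 0 (1 - |s - a| / R) - max 0 (1 - |t - a| / R)) * (b - a) ≤ (t - s) / R * (b - a) := by
      apply mul_le_mul_of_nonneg_right h1; linarith
    have h3 : (t - s) / R * (b - a) < t - s := by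
      rw [div_mul_eq_mul_div, div_lt_iff₀ hR]
      apply mul_lt_mul_of_pos_left hbR; linarith
    simp only [hr]; nlinarith
  have hsub : closedBall (a : ℂ) R ⊆ ball 0 1 := by
    apply closedBall_subset_ball'
    rw [dist_zero_right, Complex.norm_real, Real.norm_eq_abs]; linarith
  refine ⟨ρ, rz_bump_supp hR hρ hsub, by rw [hρr, hra], ?_, ?_⟩
  · intro t h1 h2
    refine ⟨r t, hra ▸ hmono a t le_rfl h1, ?_, hρr t⟩
    have := hmono t 1 h1.le h2
    rwa [hr1] at this
  · intro w t' h1 h2 h3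
    have hcont : Continuous r := by simp only [hr]; fun_prop
    obtain ⟨t, ht, hrt⟩ := intermediate_value_Ico (f := r) (a := a) (b := 1) (by linarith [hR])
      hcont.continuousOn (show t' ∈ Set.Ico (r a) (r 1) from ⟨by rw [hra]; exact h1, by rw [hr1]; exact h2⟩)
    refine ⟨t, ht.1, ht.2, ρ.injective ?_⟩
    rw [h3, hρr, hrt]

theorem rz_slit_conn {Y B σ : Set ℂ} (hY : IsPreconnected Y) (hYσ : IsOpen (Y \ σ))
    (hB : IsOpen B) (hBY : B ⊆ Y) (hσB : σ ⊆ B) (hBσ : IsPreconnected (B \ σ)) {a : ℂ} (ha : a ∈ B \ σ) :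
    IsPreconnected (Y \ σ) := by
  have haY : a ∈ Y \ σ := ⟨hBY ha.1, ha.2⟩
  set C := connectedComponentIn (Y \ σ) a with hC
  have hBC : B \ σ ⊆ C := hBσ.subset_connectedComponentIn ha (Set.sdiff_subset_sdiff_left hBY)
  have hCo : IsOpen C := hYσ.connectedComponentIn
  have hDo : IsOpen ((Y \ σ) \ C) := by
    have : (Y \ σ) \ C = ⋃ x ∈ (Y \ σ) \ C, connectedComponentIn (Y \ σ) x := by
      ext x
      simp only [Set.mem_iUnion]
      constructor
      · intro hx
        exact ⟨x, hx, mem_connectedComponentIn hx.1⟩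
      · rintro ⟨y, hy, hxy⟩
        refine ⟨connectedComponentIn_subset _ _ hxy, fun hxC => hy.2 ?_⟩
        rw [hC, connectedComponentIn_eq hxC, ← connectedComponentIn_eq hxy]
        exact mem_connectedComponentIn hy.1
    rw [this]
    exact isOpen_biUnion fun x _ => hYσ.connectedComponentIn
  have hsub : Y ⊆ C ∪ B := by
    apply hY.subset_left_of_subset_union (hCo.union hB) hDo
    · rw [Set.disjoint_left]
      rintro x (hx | hx) ⟨h1, h2⟩
      · exact h2 hx
      · exact h2 (hBC ⟨hx, h1.2⟩)
    · intro x hx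
      by_cases h1 : x ∈ σ
      · exact Or.inl (Or.inr (hσB h1))
      · by_cases h2 : x ∈ C
        · exact Or.inl (Or.inl h2)
        · exact Or.inr ⟨⟨hx, h1⟩, h2⟩
    · exact ⟨a, haY.1, Or.inr ha.1⟩
  have : Y \ σ = C := by
    apply Set.Subset.antisymm _ (connectedComponentIn_subset _ _)
    rintro x ⟨h1, h2⟩
    rcases hsub h1 with h | h
    · exact h
    · exact hBC ⟨h, h2⟩
  rw [this]
  exact isPreconnected_connectedComponentIn

/-- the slit -/
def RzSig : Set ℂ := {w | w.im = 0 ∧ 0 ≤ w.re ∧ w.re < 1}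

theorem rz_slit_disc : IsPreconnected (ball (0 : ℂ) 1 \ RzSig) := by
  have : StarConvex ℝ (-(1/4) : ℂ) (ball (0 : ℂ) 1 \ RzSig) := by
    intro w hw a b ha hb hab
    refine ⟨?_, ?_⟩
    · exact (convex_ball (0 : ℂ) 1) (by simp; norm_num) hw.1 ha hb hab
    · rintro ⟨h1, h2, h3⟩
      simp at h1 h2 h3
      rcases h1 with rfl | h1
      · simp at hab; subst hab; norm_num at h2
      · have : w.re < 0 := by
          by_contra h4
          push Not at h4
          apply hw.2
          refine ⟨h1, h4, ?_⟩
          have := hw.1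
          rw [mem_ball_zero_iff] at this
          exact (Complex.re_le_norm w).trans_lt this
        rcases hb.eq_or_lt with rfl | hb
        · have : a = 1 := by linarith
          subst this; norm_num at h2
        · nlinarith
  exact (this.isPathConnected ⟨by simp; norm_num, by simp [RzSig]⟩).isConnected.isPreconnected


theorem rz_stage1 (F : ℂ ≃ₜ ℂ) {C : ℝ} (hb : ∀ z, ‖F z - z‖ ≤ C) {X Y : Set ℂ} (hX : IsClosed X)
    (hXi : ∀ w, F w ∈ X ↔ w ∈ X) (hdX : ∀ w ∈ ball (0 : ℂ) 1, w ∉ X) (h1X : (1 : ℂ) ∈ X)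
    (hfree : ∀ w ∈ closedBall (0 : ℂ) 1, F w ∉ closedBall (0 : ℂ) 1)
    (hYd : Y = connectedComponentIn Xᶜ 0) (hF0 : F 0 ∈ Y) :
    (∀ w, F w ∈ Y ↔ w ∈ Y) ∧ ball (0 : ℂ) 1 ⊆ Y ∧
    ∃ (H : ℂ ≃ₜ ℂ) (C' : ℝ) (U : Set ℂ), (∀ z, ‖H z - z‖ ≤ C') ∧ H 0 = 0 ∧
      (∀ w, H w ∈ Y ↔ w ∈ Y) ∧ IsOpen U ∧ X ⊆ U ∧ (∀ w ∈ U, H w = F w) ∧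
      (∀ t : ℝ, 0 < t → t < 1 → H t ∉ RzSig) := by
  have h0X : (0 : ℂ) ∈ Xᶜ := hdX 0 (by simp)
  have hYo : IsOpen Y := by rw [hYd]; exact hX.isOpen_compl.connectedComponentIn
  have hYp : IsPreconnected Y := by rw [hYd]; exact isPreconnected_connectedComponentIn
  have hYX : Y ⊆ Xᶜ := by rw [hYd]; exact connectedComponentIn_subset _ _
  have hBY : ball (0 : ℂ) 1 ⊆ Y := by
    rw [hYd]
    exact (convex_ball (0 : ℂ) 1).isPreconnected.subset_connectedComponentIn (by simp) hdX
  have hFY : ∀ w, F w ∈ Y ↔ w ∈ Y := by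
    have h := F.image_connectedComponentIn h0X
    have hFX : F '' Xᶜ = Xᶜ := by
      ext x
      constructor
      · rintro ⟨y, hy, rfl⟩ h
        exact hy ((hXi y).1 h)
      · intro hx
        refine ⟨F.symm x, fun h => hx ?_, by simp⟩
        have := (hXi _).2 h
        simpa using this
    rw [hFX] at h
    have h2 : connectedComponentIn Xᶜ (F 0) = Y := by
      rw [hYd] at hF0 ⊢
      exact (connectedComponentIn_eq hF0).symm
    rw [h2, ← hYd] at h
    intro w
    constructor
    · intro hw
      rw [← h] at hw
      obtain ⟨y, hy, hyx⟩ := hw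
      rwa [← F.injective hyx]
    · intro hw
      rw [← h]
      exact ⟨w, hw, rfl⟩
  refine ⟨hFY, hBY, ?_⟩
  have hσB : RzSig ⊆ ball (0 : ℂ) 1 := by
    rintro w ⟨h1, h2, h3⟩
    rw [mem_ball_zero_iff]
    have : w = (w.re : ℂ) := by apply Complex.ext <;> simp [h1]
    rw [this, Complex.norm_real, Real.norm_eq_abs, abs_of_nonneg h2]
    exact h3
  have hreal : ∀ t : ℝ, 0 ≤ t → t < 1 → (t : ℂ) ∈ RzSig := fun t h0 h1 => by
    simp [RzSig, h0, h1]
  have hYσ : IsOpen (Y \ RzSig) := by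
    have : Y \ RzSig = Y ∩ ((fun t : ℝ => (t : ℂ)) '' Set.Icc 0 1)ᶜ := by
      ext w
      constructor
      · rintro ⟨h1, h2⟩
        refine ⟨h1, ?_⟩
        rintro ⟨t, ht, rfl⟩
        rcases ht.2.lt_or_eq with h | rfl
        · exact h2 (hreal t ht.1 h)
        · exact hYX h1 (by simpa using h1X)
      · rintro ⟨h1, h2⟩
        refine ⟨h1, ?_⟩
        rintro ⟨h3, h4, h5⟩
        exact h2 ⟨w.re, ⟨h4, h5.le⟩, by apply Complex.ext <;> simp [h3]⟩
    rw [this]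
    exact hYo.inter (isCompact_Icc.image Complex.continuous_ofReal).isClosed.isOpen_compl
  have h4B : (-(1/4) : ℂ) ∈ ball (0 : ℂ) 1 \ RzSig := ⟨by simp; norm_num, by simp [RzSig]⟩
  have hV := rz_slit_conn hYp hYσ isOpen_ball hBY hσB rz_slit_disc h4B
  obtain ⟨φ₁, hφ₁, hφ₁F⟩ := rz_homog hYσ hV (a := F 0) (b := -(1/4)) ⟨hF0, fun h =>
    hfree 0 (by simp) (ball_subset_closedBall (hσB h))⟩ ⟨hBY h4B.1, h4B.2⟩
  -- the compact set of parameters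
  set g : ℝ → ℂ := fun t => φ₁ (F t) with hg
  have hgc : Continuous g := by
    have := F.continuous
    have := φ₁.continuous
    fun_prop
  have hcb : ∀ t : ℝ, 0 ≤ t → t ≤ 1 → (t : ℂ) ∈ closedBall (0 : ℂ) 1 := by
    intro t h0 h1
    rw [mem_closedBall_zero_iff, Complex.norm_real, Real.norm_eq_abs, abs_of_nonneg h0]
    exact h1
  have hgσ : ∀ t : ℝ, 0 ≤ t → t ≤ 1 → g t ∉ RzSig := by
    intro t h0 h1 h
    have : φ₁ (F t) = F t := by
      have h2 : F t ∉ Y \ RzSig := by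
        rw [← hφ₁.mem_iff]
        exact fun h' => h'.2 h
      exact hφ₁.eq h2
    rw [hg] at h
    simp only [this] at h
    exact hfree t (hcb t h0 h1) (ball_subset_closedBall (hσB h))
  set Sset : Set ℝ := Set.Icc 0 (1/4) ∩ (fun s : ℝ => (-(s : ℂ))) ⁻¹' (g '' Set.Icc 0 1) with hS
  have hSc : IsCompact Sset := by
    apply isCompact_Icc.inter_right
    apply IsClosed.preimage (by fun_prop)
    exact (isCompact_Icc.image hgc).isClosed
  have hSne : Sset.Nonempty := by
    refine ⟨1/4, ⟨by norm_num, by norm_num⟩, 0, ⟨by norm_num, by norm_num⟩, ?_⟩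
    simp only [hg, Complex.ofReal_zero, hφ₁F]
    push_cast; norm_num
  obtain ⟨s, ⟨⟨hs0, hs1⟩, q, ⟨hq0, hq1⟩, hgq⟩, hsmin⟩ := hSc.exists_isLeast hSne
  simp only at hgq
  have hs0' : 0 < s := by
    rcases hs0.eq_or_lt with h | h
    · exfalso
      apply hgσ q hq0 hq1
      rw [hgq, ← h]; simp [RzSig]
    · exact h
  have hq1' : q < 1 := by
    rcases hq1.lt_or_eq with h | h
    · exact h
    · exfalso
      subst h
      have hF1 : F 1 ∈ X := (hXi 1).2 h1X
      have : g 1 = F 1 := by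
        simp only [hg, Complex.ofReal_one]
        exact hφ₁.eq fun h => hYX h.1 hF1
      rw [this] at hgq
      rw [hgq] at hF1
      refine hdX _ ?_ hF1
      rw [mem_ball_zero_iff, norm_neg, Complex.norm_real, Real.norm_eq_abs, abs_of_nonneg hs0]
      linarith
  obtain ⟨ψ, hψ, hψ0, hψt, -⟩ := rz_push (a := 0) (b := q) (R := (1 + q) / 2) hq0 (by linarith)
    (by simp; linarith)
  obtain ⟨φ₂, hφ₂, hφ₂0, -, hφ₂t⟩ := rz_push (a := -s) (b := 0) (R := 1 / 2) (by linarith)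
    (by linarith) (by rw [abs_neg, abs_of_nonneg hs0]; linarith)
  have hψ' := hψ.mono hBY
  have hφ₂' := hφ₂.mono hBY
  have hφ₁' := hφ₁.mono (Set.sdiff_subset : Y \ RzSig ⊆ Y)
  obtain ⟨C1, hC1⟩ := hψ.bounded
  obtain ⟨C2, hC2⟩ := hφ₁.bounded
  obtain ⟨C3, hC3⟩ := hφ₂.bounded
  obtain ⟨K1, hK1, hK1c, hK1e⟩ := hψ'
  obtain ⟨K2, hK2, hK2c, hK2e⟩ := hφ₁'
  obtain ⟨K3, hK3, hK3c, hK3e⟩ := hφ₂'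
  refine ⟨((ψ.trans F).trans φ₁).trans φ₂, C1 + C + C2 + C3,
    (K1 ∪ F ⁻¹' (K2 ∪ K3))ᶜ, ?_, ?_, ?_, ?_, ?_, ?_, ?_⟩
  · intro z
    simp only [Homeomorph.trans_apply]
    have e : φ₂ (φ₁ (F (ψ z))) - z = (ψ z - z) + (F (ψ z) - ψ z) + (φ₁ (F (ψ z)) - F (ψ z)) +
      (φ₂ (φ₁ (F (ψ z))) - φ₁ (F (ψ z))) := by ring
    rw [e]
    refine (norm_add_le _ _).trans (add_le_add ?_ (hC3 _))
    refine (norm_add_le _ _).trans (add_le_add ?_ (hC2 _))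
    exact (norm_add_le _ _).trans (add_le_add (hC1 _) (hb _))
  · simp only [Homeomorph.trans_apply]
    rw [Complex.ofReal_zero] at hψ0
    rw [hψ0]
    change φ₂ (g q) = 0
    rw [hgq]
    simpa using hφ₂0
  · intro w
    simp only [Homeomorph.trans_apply]
    rw [(hφ₂.mono hBY).mem_iff, (hφ₁.mono (Set.sdiff_subset : Y \ RzSig ⊆ Y)).mem_iff, hFY,
      (hψ.mono hBY).mem_iff]
  · exact (hK1c.isClosed.union ((hK2c.isClosed.union hK3c.isClosed).preimage F.continuous)).isOpen_compl
  · rintro x hx (h | h | h)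
    · exact hYX (hK1 h) hx
    · exact hYX (hK2 h) ((hXi x).2 hx)
    · exact hYX (hK3 h) ((hXi x).2 hx)
  · intro w hw
    simp only [Set.mem_compl_iff, Set.mem_union, Set.mem_preimage, not_or] at hw
    simp only [Homeomorph.trans_apply]
    rw [hK1e w hw.1, hK2e _ hw.2.1, hK3e _ hw.2.2]
  · intro t ht0 ht1 hσ
    simp only [Homeomorph.trans_apply] at hσ
    obtain ⟨t', ht'q, ht'1, hψtt⟩ := hψt t ht0 ht1
    rw [hψtt] at hσ
    change φ₂ (g t') ∈ RzSig at hσ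
    obtain ⟨h1, h2, h3⟩ := hσ
    obtain ⟨r, hr1, hr2, hr3⟩ := hφ₂t (g t') (φ₂ (g t')).re (by simpa using h2) h3
      (by apply Complex.ext <;> simp [h1])
    rcases le_or_gt 0 r with hr | hr
    · exact hgσ t' (hq0.trans ht'q.le) ht'1.le (hr3 ▸ hreal r hr hr2)
    · have hle : s ≤ -r := hsmin ⟨⟨by linarith, by linarith⟩, t', ⟨hq0.trans ht'q.le, ht'1.le⟩, by
        simp [hr3]⟩
      have hrs : r = -s := by linarith
      have : g t' = g q := by rw [hgq, hr3, hrs]; simp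
      have := F.injective (φ₁.injective this)
      have := Complex.ofReal_injective this
      linarith


theorem rz_lift_fun (H : ℂ → ℂ) (hH : Continuous H) (h0 : ∀ w, w ≠ 0 → H w ≠ 0) {C : ℝ}
    (hb : ∀ z, ‖H z - z‖ ≤ C) :
    ∃ L : ℂ → ℂ, Continuous L ∧ (∀ ζ, Complex.exp (L ζ) = H (Complex.exp ζ)) ∧
      (∀ δ > 0, ∃ R : ℝ, ∀ ζ : ℂ, R < ζ.re → ‖L ζ - ζ‖ < δ) := by
  have hC : 0 ≤ C := (norm_nonneg _).trans (hb 0)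
  set R0 : ℝ := Real.log (2 * C + 2) with hR0
  set Q : ℂ → ℂ := fun ζ => H (Complex.exp ζ) / Complex.exp ζ with hQ
  have hQc : Continuous Q := (hH.comp Complex.continuous_exp).div Complex.continuous_exp
    (fun ζ => Complex.exp_ne_zero ζ)
  have hQ1 : ∀ ζ, ‖Q ζ - 1‖ ≤ C / Real.exp ζ.re := by
    intro ζ
    rw [hQ]
    simp only
    rw [div_sub_one (Complex.exp_ne_zero ζ), norm_div, Complex.norm_exp]
    gcongr
    exact hb _
  have hQ2 : ∀ ζ : ℂ, R0 < ζ.re → ‖Q ζ - 1‖ ≤ 1 / 2 := by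
    intro ζ hζ
    refine (hQ1 ζ).trans ?_
    rw [hR0, Real.log_lt_iff_lt_exp (by positivity)] at hζ
    rw [div_le_div_iff₀ (Real.exp_pos _) (by norm_num)]
    linarith
  have hQe : ∀ ζ, Complex.exp (ζ + Complex.log (Q ζ)) = H (Complex.exp ζ) := by
    intro ζ
    rw [Complex.exp_add, Complex.exp_log, hQ]
    · field_simp
    · exact div_ne_zero (h0 _ (Complex.exp_ne_zero ζ)) (Complex.exp_ne_zero ζ)
  obtain ⟨L, hL, hLa, hLe⟩ := rz_exists_log (fun ζ => H (Complex.exp ζ)) (by fun_prop)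
    (fun ζ => h0 _ (Complex.exp_ne_zero ζ)) ((R0 + 1 : ℝ) : ℂ) _ (hQe ((R0 + 1 : ℝ) : ℂ))
  have hLQ : ∀ ζ : ℂ, R0 < ζ.re → L ζ = ζ + Complex.log (Q ζ) := by
    intro ζ hζ
    refine rz_log_unique (s := {ζ : ℂ | R0 < ζ.re}) (m := fun ζ => ζ + Complex.log (Q ζ)) (convex_halfSpace_re_gt R0).isPreconnected
      hL.continuousOn ?_ ?_ (x := ((R0 + 1 : ℝ) : ℂ)) (by simp) hζ hLa
    · apply continuousOn_id.add
      apply hQc.continuousOn.clog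
      intro ζ hζ
      exact rz_slit ((hQ2 ζ hζ).trans_lt (by norm_num))
    · intro ζ _
      rw [hLe, hQe]
  refine ⟨L, hL, hLe, fun δ hδ => ⟨max R0 (Real.log (2 * C / δ + 1)), fun ζ hζ => ?_⟩⟩
  have h1 := (le_max_left _ _).trans_lt hζ
  have h2 := (le_max_right _ _).trans_lt hζ
  rw [hLQ ζ h1, add_sub_cancel_left]
  have h3 := Complex.norm_log_one_add_half_le_self (hQ2 ζ h1)
  rw [add_sub_cancel] at h3
  refine h3.trans_lt ?_
  rw [Real.log_lt_iff_lt_exp (by positivity)] at h2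
  have h4 := hQ1 ζ
  have h5 : 3 / 2 * (C / Real.exp ζ.re) < δ := by
    rw [← mul_div_assoc, div_lt_iff₀ (Real.exp_pos _)]
    have : δ * (2 * C / δ + 1) < δ * Real.exp ζ.re := by gcongr
    have e : δ * (2 * C / δ + 1) = 2 * C + δ := by field_simp
    linarith
  linarith

theorem rz_lift_homeo (H : ℂ ≃ₜ ℂ) (h0 : H 0 = 0) {C : ℝ} (hb : ∀ z, ‖H z - z‖ ≤ C) :
    ∃ L : ℂ ≃ₜ ℂ, (∀ ζ, Complex.exp (L ζ) = H (Complex.exp ζ)) ∧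
      (∀ (k : ℤ) (ζ : ℂ), L (ζ + k * (2 * Real.pi * Complex.I)) = L ζ + k * (2 * Real.pi * Complex.I)) ∧
      (∀ n : ℕ, ∀ δ > 0, ∃ R : ℝ, ∀ ζ : ℂ, R < ζ.re → ‖L^[n] ζ - ζ‖ < δ) := by
  have hn0 : ∀ w, w ≠ 0 → H w ≠ 0 := fun w hw h => hw (H.injective (h.trans h0.symm))
  have hn0' : ∀ w, w ≠ 0 → H.symm w ≠ 0 := fun w hw h => hw (by rw [← H.apply_symm_apply w, h, h0])
  have hb' : ∀ z, ‖H.symm z - z‖ ≤ C := fun z => by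
    have := hb (H.symm z)
    rwa [H.apply_symm_apply, norm_sub_rev] at this
  obtain ⟨L, hL, hLe, hLd⟩ := rz_lift_fun H H.continuous hn0 hb
  obtain ⟨M, hM, hMe, hMd⟩ := rz_lift_fun H.symm H.symm.continuous hn0' hb'
  have hpi := Real.pi_gt_three
  have hre : ∀ {a b : ℂ}, ‖a - b‖ < 1 → b.re - 1 < a.re := by
    intro a b hab
    have := (Complex.abs_re_le_norm (a - b)).trans_lt hab
    rw [abs_lt, Complex.sub_re] at this
    linarith [this.1]
  obtain ⟨R1, hR1⟩ := hLd 1 one_pos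
  obtain ⟨R2, hR2⟩ := hMd 1 one_pos
  have hclose : ∀ f : ℂ → ℂ, Continuous f → (∀ ζ, Complex.exp (f ζ) = Complex.exp ζ) →
      ∀ ζ0, ‖f ζ0 - ζ0‖ < 2 * Real.pi → ∀ ζ, f ζ = ζ := by
    intro f hf hfe ζ0 hζ0 ζ
    refine rz_log_unique (s := Set.univ) isPreconnected_univ hf.continuousOn continuousOn_id
      (fun ζ _ => hfe ζ) (Set.mem_univ ζ0) (Set.mem_univ ζ) ?_
    exact sub_eq_zero.1 (rz_int_close (rz_log_diff (hfe ζ0)) hζ0)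
  have h1 : ∀ ζ, M (L ζ) = ζ := by
    refine hclose (fun ζ => M (L ζ)) (hM.comp hL) (fun ζ => by rw [hMe, hLe, H.symm_apply_apply])
      ((max R1 R2 + 2 : ℝ) : ℂ) ?_
    set z : ℂ := ((max R1 R2 + 2 : ℝ) : ℂ) with hz
    have hzr : z.re = max R1 R2 + 2 := by simp [hz]
    have a1 := hR1 z (by rw [hzr]; linarith [le_max_left R1 R2])
    have a2 := hR2 (L z) (by have := hre a1; rw [hzr] at this; linarith [le_max_right R1 R2])
    calc ‖M (L z) - z‖ = ‖(M (L z) - L z) + (L z - z)‖ := by ring_nf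
      _ ≤ _ := norm_add_le _ _
      _ < 2 * Real.pi := by linarith
  have h2 : ∀ ζ, L (M ζ) = ζ := by
    refine hclose (fun ζ => L (M ζ)) (hL.comp hM) (fun ζ => by rw [hLe, hMe, H.apply_symm_apply])
      ((max R1 R2 + 2 : ℝ) : ℂ) ?_
    set z : ℂ := ((max R1 R2 + 2 : ℝ) : ℂ) with hz
    have hzr : z.re = max R1 R2 + 2 := by simp [hz]
    have a1 := hR2 z (by rw [hzr]; linarith [le_max_right R1 R2])
    have a2 := hR1 (M z) (by have := hre a1; rw [hzr] at this; linarith [le_max_left R1 R2])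
    calc ‖L (M z) - z‖ = ‖(L (M z) - M z) + (M z - z)‖ := by ring_nf
      _ ≤ _ := norm_add_le _ _
      _ < 2 * Real.pi := by linarith
  have hexpk : ∀ (k : ℤ) (ζ : ℂ), Complex.exp (ζ + k * (2 * Real.pi * Complex.I)) = Complex.exp ζ := by
    intro k ζ
    rw [Complex.exp_eq_exp_iff_exists_int]
    exact ⟨k, rfl⟩
  refine ⟨⟨⟨L, M, h1, h2⟩, hL, hM⟩, hLe, ?_, ?_⟩
  · intro k ζ
    change L (ζ + k * (2 * Real.pi * Complex.I)) = L ζ + k * (2 * Real.pi * Complex.I)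
    set c : ℂ := k * (2 * Real.pi * Complex.I) with hc
    have hcre : c.re = 0 := by simp [hc]
    refine rz_log_unique (s := Set.univ) (l := fun ζ => L (ζ + c)) (m := fun ζ => L ζ + c)
      isPreconnected_univ
      (by fun_prop) (by fun_prop) ?_ (Set.mem_univ ((R1 + 1 : ℝ) : ℂ)) (Set.mem_univ ζ) ?_
    · intro ζ _
      rw [hLe, hc, hexpk, hexpk, hLe]
    · set z : ℂ := ((R1 + 1 : ℝ) : ℂ) with hz
      have hzr : z.re = R1 + 1 := by simp [hz]
      have a1 := hR1 z (by rw [hzr]; linarith)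
      have a2 := hR1 (z + c) (by rw [Complex.add_re, hzr, hcre]; linarith)
      apply sub_eq_zero.1
      apply rz_int_close (rz_log_diff _)
      · calc ‖L (z + c) - (L z + c)‖ = ‖(L (z + c) - (z + c)) - (L z - z)‖ := by ring_nf
          _ ≤ _ := norm_sub_le _ _
          _ < 2 * Real.pi := by linarith
      · rw [hLe, hc, hexpk, hexpk, hLe]
  · intro n
    change ∀ δ > 0, ∃ R : ℝ, ∀ ζ : ℂ, R < ζ.re → ‖L^[n] ζ - ζ‖ < δ
    induction n with
    | zero => intro δ hδ; exact ⟨0, fun ζ _ => by simpa using hδ⟩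
    | succ n ih =>
      intro δ hδ
      obtain ⟨Ra, ha⟩ := ih (min 1 (δ / 2)) (by positivity)
      obtain ⟨Rb, hb⟩ := hLd (δ / 2) (by positivity)
      refine ⟨max Ra (Rb + 1), fun ζ hζ => ?_⟩
      have b1 := ha ζ ((le_max_left _ _).trans_lt hζ)
      have b2 := hb (L^[n] ζ) (by
        have := hre (b1.trans_le (min_le_left _ _))
        have := (le_max_right _ _).trans_lt hζ
        linarith)
      rw [Function.iterate_succ_apply']
      calc ‖L (L^[n] ζ) - ζ‖ = ‖(L (L^[n] ζ) - L^[n] ζ) + (L^[n] ζ - ζ)‖ := by ring_nf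
        _ ≤ _ := norm_add_le _ _
        _ < δ := by have := b1.trans_le (min_le_right _ _); linarith


/-- the lifted slit -/
def RzSigT : Set ℂ := {ζ | ζ.im = 0 ∧ ζ.re < 0}

theorem rz_NC_lift {X : Set ℂ} (hn : RzNC X) : RzNC (Complex.exp ⁻¹' X) := by
  intro O hO hc
  have h1 : Complex.exp '' (Complex.exp ⁻¹' X ∩ O) = X ∩ Complex.exp '' O := by
    ext w
    constructor
    · rintro ⟨ζ, ⟨h1, h2⟩, rfl⟩
      exact ⟨h1, ζ, h2, rfl⟩
    · rintro ⟨h1, ζ, h2, rfl⟩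
      exact ⟨ζ, ⟨h1, h2⟩, rfl⟩
  have h2 := hn (Complex.exp '' O) (Complex.isOpenMap_exp O hO) (h1 ▸ hc.image Complex.continuous_exp)
  rw [← h1] at h2
  simpa using h2

theorem rz_exp_period (k : ℤ) (ζ : ℂ) :
    Complex.exp (ζ + k * (2 * Real.pi * Complex.I)) = Complex.exp ζ := by
  rw [Complex.exp_eq_exp_iff_exists_int]
  exact ⟨k, rfl⟩

/-- a path around a non-compact connected closed set: the winding argument -/
theorem rz_no_path {X : Set ℂ} (hX : IsClosed X) (hn : RzNC X) (h0 : (0 : ℂ) ∈ X)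
    (hre : ∀ s ∈ X, 0 ≤ s.re) (a b : ℂ) (ha : a = -1 + Complex.I) (hb : b = -1 - Complex.I) (γ : Path a b)
    (hγX : ∀ t, γ t ∉ X) (hγ : ∀ t, γ t ∈ Complex.slitPlane) : False := by
  classical
  have haX : ∀ s ∈ X, a - s ≠ 0 := by
    intro s hs h
    have := hre s hs
    rw [← sub_eq_zero.1 h] at this
    simp [ha] at this
    linarith
  have hne : ∀ (t : unitInterval) (s : X), (γ t - s) / (a - s) ≠ 0 := by
    intro t s
    refine div_ne_zero (sub_ne_zero.2 fun h => hγX t (h ▸ s.2)) (haX s s.2)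
  have hcont : Continuous fun p : unitInterval × X => (γ p.1 - p.2) / (a - p.2) := by
    apply Continuous.div
    · have := γ.continuous
      fun_prop
    · fun_prop
    · rintro ⟨t, s⟩
      exact haX s s.2
  let Hm : C(unitInterval × X, {z : ℂ // z ≠ 0}) :=
    ⟨fun p => ⟨(γ p.1 - p.2) / (a - p.2), hne p.1 p.2⟩, by fun_prop⟩
  have hH0 : ∀ s : X, Hm (0, s) = (⟨_, Complex.exp_ne_zero ((0 : C(X, ℂ)) s)⟩ : {z : ℂ // z ≠ 0}) := by
    intro s
    apply Subtype.ext
    simp only [Hm, ContinuousMap.coe_mk, ContinuousMap.zero_apply, Complex.exp_zero, Path.source]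
    exact div_self (haX s s.2)
  obtain ⟨g, hge, hg0⟩ : ∃ g : C(unitInterval × X, ℂ), (∀ t s, Complex.exp (g (t, s)) = (γ t - s) / (a - s)) ∧
      ∀ s, g (0, s) = 0 := by
    refine ⟨Complex.isCoveringMap_exp.liftHomotopy Hm 0 hH0, fun t s => ?_, fun s => ?_⟩
    · have := congrFun (Complex.isCoveringMap_exp.liftHomotopy_lifts Hm 0 hH0) (t, s)
      exact congrArg Subtype.val this
    · exact Complex.isCoveringMap_exp.liftHomotopy_zero Hm 0 hH0 s
  have hgt : ∀ s : X, Continuous fun t => g (t, s) := fun s => by fun_prop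
  have hslit : ∀ s ∈ X, (b - s) / (a - s) ∈ Complex.slitPlane := by
    intro s hs
    rw [Complex.mem_slitPlane_iff_not_le_zero]
    intro hle
    set r := (b - s) / (a - s) with hr
    have h1 : b - s = r * (a - s) := by rw [hr, div_mul_cancel₀ _ (haX s hs)]
    rw [Complex.le_def] at hle
    simp only [Complex.zero_re, Complex.zero_im] at hle
    have h2 := congrArg Complex.re h1
    simp [hb, ha, hle.2] at h2
    have := hre s hs
    nlinarith [hle.1]
  have hu : ∀ s : X, g (1, s) = Complex.log ((b - s) / (a - s)) := by
    have hdef : ∀ s : X, (fun z : ℂ => (if h : z ∈ X then g (1, ⟨z, h⟩) else 0) -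
        Complex.log ((b - z) / (a - z))) s = g (1, s) - Complex.log ((b - s) / (a - s)) := by
      intro s
      simp
    obtain ⟨Rγ, hRγ⟩ := (isCompact_range (γ.continuous)).isBounded.exists_norm_le
    intro s
    have := rz_NC_zero hX hn (u := fun z : ℂ => (if h : z ∈ X then g (1, ⟨z, h⟩) else 0) -
        Complex.log ((b - z) / (a - z))) (R := Rγ + 2 * ‖a‖ + 1) ?_ ?_ ?_ s.2
    · exact sub_eq_zero.1 ((hdef s).symm.trans this)
    · rw [continuousOn_iff_continuous_domRestrict]
      have e : X.domRestrict (fun z : ℂ => (if h : z ∈ X then g (1, ⟨z, h⟩) else 0) -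
        Complex.log ((b - z) / (a - z))) = fun s : X => g (1, s) - Complex.log ((b - s) / (a - s)) := by
        ext s
        exact hdef s
      rw [e]
      apply Continuous.sub (by fun_prop)
      apply Continuous.clog
      · apply Continuous.div (by fun_prop) (by fun_prop)
        exact fun s => haX s s.2
      · exact fun s => hslit s s.2
    · intro z hz
      have := hdef ⟨z, hz⟩
      simp only at this
      rw [this]
      apply rz_log_diff
      rw [hge, Path.target, Complex.exp_log]
      exact Complex.slitPlane_ne_zero (hslit z hz)
    · intro z hz hzR
      have := hdef ⟨z, hz⟩
      simp only at this
      rw [this]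
      have hsm : ∀ t, (γ t - z) / (a - z) ∈ Complex.slitPlane := by
        intro t
        apply rz_slit
        rw [div_sub_one (haX z hz), norm_div, div_lt_one (norm_pos_iff.2 (haX z hz))]
        have h1 := hRγ (γ t) ⟨t, rfl⟩
        have h2 : ‖γ t - z - (a - z)‖ ≤ ‖γ t‖ + ‖a‖ := by
          rw [sub_sub_sub_cancel_right]; exact norm_sub_le _ _
        have h3 : ‖z‖ - ‖a‖ ≤ ‖a - z‖ := by rw [norm_sub_rev]; exact norm_sub_norm_le z a
        linarith
      have key := rz_log_unique (s := (Set.univ : Set unitInterval)) (l := fun t => g (t, ⟨z, hz⟩))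
        (m := fun t => Complex.log ((γ t - z) / (a - z))) isPreconnected_univ
        (hgt _).continuousOn (Continuous.continuousOn (by
          apply Continuous.clog _ hsm
          apply Continuous.div (by have := γ.continuous; fun_prop) (by fun_prop)
          exact fun _ => haX z hz)) (fun t _ => by
            rw [hge, Complex.exp_log (Complex.slitPlane_ne_zero (hsm t))]) (Set.mem_univ 0) (Set.mem_univ 1)
            (by rw [hg0, Path.source, div_self (haX z hz), Complex.log_one])
      simp only [Path.target] at key
      rw [key, sub_self]
  have h2 := hu ⟨0, h0⟩
  have key := rz_log_unique (s := (Set.univ : Set unitInterval)) (l := fun t => g (t, ⟨0, h0⟩))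
        (m := fun t => Complex.log (γ t) - Complex.log a) isPreconnected_univ
        (hgt _).continuousOn (Continuous.continuousOn (by
          apply Continuous.sub _ continuous_const
          exact Continuous.clog γ.continuous hγ)) (fun t _ => by
            rw [hge, Complex.exp_sub, Complex.exp_log (Complex.slitPlane_ne_zero (hγ t)), Complex.exp_log]
            · simp
            · simpa using haX 0 h0) (Set.mem_univ 0) (Set.mem_univ 1)
            (by rw [hg0, Path.source, sub_self])
  simp only [Path.target] at key
  rw [h2] at key
  simp only [sub_zero] at key
  have hba : b / a = Complex.I := by
    rw [div_eq_iff (by simpa using haX 0 h0), ha, hb]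
    ring_nf
    simp
    ring
  rw [hba] at key
  have him := congrArg Complex.im key
  rw [Complex.sub_im, Complex.log_im, Complex.log_im, Complex.log_im, Complex.arg_I] at him
  have hpa : 0 ≤ Complex.arg a := by rw [Complex.arg_nonneg_iff]; simp [ha]
  have hpb : Complex.arg b < 0 := by rw [Complex.arg_neg_iff]; simp [hb]
  linarith [Real.pi_pos]


theorem rz_Yt_conn {Y : Set ℂ} (hYo : IsOpen Y) (hYc : IsPreconnected Y) (hdY : ball (0:ℂ) 1 ⊆ Y) :
    IsPreconnected (Complex.exp ⁻¹' Y) := by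
  set Yt := Complex.exp ⁻¹' Y with hYt
  have hYto : IsOpen Yt := hYo.preimage Complex.continuous_exp
  have hball : ∀ ζ : ℂ, Complex.exp ζ ∈ ball (0:ℂ) 1 ↔ ζ.re < 0 := by
    intro ζ
    rw [mem_ball_zero_iff, Complex.norm_exp, Real.exp_lt_one_iff]
  have hPc : IsPreconnected {ζ : ℂ | ζ.re < 0} := (convex_halfSpace_re_lt 0).isPreconnected
  have hPY : {ζ : ℂ | ζ.re < 0} ⊆ Yt := fun ζ h => hdY ((hball ζ).2 h)
  have hm1 : (-1 : ℂ) ∈ {ζ : ℂ | ζ.re < 0} := by simp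
  set C := connectedComponentIn Yt (-1) with hC
  have hPC : {ζ : ℂ | ζ.re < 0} ⊆ C := hPc.subset_connectedComponentIn hm1 hPY
  have hCo : IsOpen C := hYto.connectedComponentIn
  have hCY : C ⊆ Yt := connectedComponentIn_subset _ _
  have hCt : ∀ (k : ℤ), ∀ ζ ∈ C, ζ + k * (2 * Real.pi * Complex.I) ∈ C := by
    intro k ζ hζ
    have h1 : IsPreconnected ((fun z : ℂ => z + k * (2 * Real.pi * Complex.I)) '' C) :=
      isPreconnected_connectedComponentIn.image _ (by fun_prop)
    have h2 : (fun z : ℂ => z + k * (2 * Real.pi * Complex.I)) '' C ⊆ Yt := by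
      rintro _ ⟨z, hz, rfl⟩
      have := hCY hz
      simp only [hYt, Set.mem_preimage] at this ⊢
      rwa [rz_exp_period]
    have h3 : (-1 : ℂ) + k * (2 * Real.pi * Complex.I) ∈ C := hPC (by simp)
    have h4 := h1.subset_connectedComponentIn (x := (-1 : ℂ) + k * (2 * Real.pi * Complex.I))
      ⟨-1, hPC hm1, rfl⟩ h2
    rw [← connectedComponentIn_eq h3] at h4
    exact h4 ⟨ζ, hζ, rfl⟩
  suffices h : Yt ⊆ C by
    have : Yt = C := h.antisymm hCY
    rw [this]; exact isPreconnected_connectedComponentIn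
  have hDo : IsOpen (Yt \ C) := by
    rw [isOpen_iff_mem_nhds]
    rintro ζ ⟨h1, h2⟩
    refine mem_of_superset ((hYto.connectedComponentIn (x := ζ)).mem_nhds (mem_connectedComponentIn h1)) ?_
    intro z hz
    refine ⟨connectedComponentIn_subset _ _ hz, fun hzC => h2 ?_⟩
    have e1 := connectedComponentIn_eq hz
    have e2 := connectedComponentIn_eq hzC
    rw [hC, e2, ← e1]
    exact mem_connectedComponentIn h1
  intro ζ hζ
  by_contra hζC
  have := hYc (Complex.exp '' C ∪ ball 0 1) (Complex.exp '' (Yt \ C))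
    ((Complex.isOpenMap_exp C hCo).union isOpen_ball) (Complex.isOpenMap_exp _ hDo) ?_ ?_ ?_
  · obtain ⟨y, hy, h1, ⟨d, hd, rfl⟩⟩ := this
    rcases h1 with ⟨c, hc, hcd⟩ | h1
    · obtain ⟨k, hk⟩ := Complex.exp_eq_exp_iff_exists_int.1 hcd.symm
      exact hd.2 (hk ▸ hCt k c hc)
    · exact hd.2 (hPC ((hball d).1 h1))
  · intro y hy
    by_cases h0 : y = 0
    · left; right; simp [h0]
    · have e := Complex.exp_log h0
      by_cases hc : Complex.log y ∈ C
      · left; left; exact ⟨_, hc, e⟩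
      · right; exact ⟨_, ⟨by simp only [hYt, Set.mem_preimage]; rwa [e], hc⟩, e⟩
  · exact ⟨0, hdY (by simp), Or.inr (by simp)⟩
  · exact ⟨Complex.exp ζ, hζ, ζ, ⟨hζ, hζC⟩, rfl⟩

theorem rz_sides {X Y : Set ℂ} (hX : IsClosed X) (hn : RzNC X) (h1X : (1:ℂ) ∈ X)
    (hYo : IsOpen Y) (hYc : IsPreconnected Y) (hdY : ball (0:ℂ) 1 ⊆ Y) (hYX : ∀ y ∈ Y, y ∉ X) :
    IsOpen (Complex.exp ⁻¹' Y \ RzSigT) ∧ RzSigT ⊆ Complex.exp ⁻¹' Y ∧ ∃ A : ℤ → Set ℂ,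
    (∀ ε, ε = 1 ∨ ε = -1 → IsOpen (A ε) ∧ IsPreconnected (A ε) ∧ A ε ⊆ Complex.exp ⁻¹' Y \ RzSigT ∧
      IsPreconnected (A ε ∪ RzSigT) ∧ (A ε).Nonempty ∧
      ∀ ζ, Complex.exp ζ ∈ Y → ∃ J : ℕ, ∀ j : ℕ, J ≤ j →
        ζ + ((ε * j : ℤ) : ℂ) * (2 * Real.pi * Complex.I) ∈ A ε) ∧
    (Complex.exp ⁻¹' Y \ RzSigT ⊆ A 1 ∪ A (-1)) ∧ (∀ ζ ∈ A 1, ζ ∉ A (-1)) := by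
  have hYtc := rz_Yt_conn hYo hYc hdY
  set Yt := Complex.exp ⁻¹' Y with hYt
  have hYto : IsOpen Yt := hYo.preimage Complex.continuous_exp
  have hball : ∀ ζ : ℂ, Complex.exp ζ ∈ ball (0:ℂ) 1 ↔ ζ.re < 0 := by
    intro ζ
    rw [mem_ball_zero_iff, Complex.norm_exp, Real.exp_lt_one_iff]
  have hPY : {ζ : ℂ | ζ.re < 0} ⊆ Yt := fun ζ h => hdY ((hball ζ).2 h)
  have hσY : RzSigT ⊆ Yt := fun ζ h => hPY h.2
  have h0Y : (0 : ℂ) ∉ Yt := by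
    intro h
    simp only [hYt, Set.mem_preimage, Complex.exp_zero] at h
    exact hYX 1 h h1X
  have hslit : Yt \ RzSigT = Yt ∩ Complex.slitPlane := by
    ext ζ
    simp only [RzSigT, Set.mem_sdiff, Set.mem_inter_iff, Set.mem_ofPred_eq, Complex.mem_slitPlane_iff]
    constructor
    · rintro ⟨h1, h2⟩
      refine ⟨h1, ?_⟩
      by_contra! h3
      refine h2 ⟨h3.2, lt_of_le_of_ne h3.1 fun h => h0Y ?_⟩
      have : ζ = 0 := Complex.ext h h3.2
      exact this ▸ h1
    · rintro ⟨h1, h2⟩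
      refine ⟨h1, fun h3 => ?_⟩
      rcases h2 with h | h
      · linarith [h3.2]
      · exact h h3.1
  have hSo : IsOpen (Yt \ RzSigT) := by
    rw [hslit]; exact hYto.inter Complex.isOpen_slitPlane
  refine ⟨hSo, hσY, fun ε => connectedComponentIn (Yt \ RzSigT) (-1 + ε * Complex.I), ?_⟩
  have hne : ∀ ε : ℤ, ε = 1 ∨ ε = -1 → ε * ε = 1 := by
    rintro ε (h | h) <;> subst h <;> norm_num
  have hquart : ∀ ε : ℤ, ε = 1 ∨ ε = -1 → {ζ : ℂ | ζ.re < 0 ∧ 0 < (ε:ℝ) * ζ.im} ⊆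
      connectedComponentIn (Yt \ RzSigT) (-1 + ε * Complex.I) := by
    intro ε hε
    apply IsPreconnected.subset_connectedComponentIn
    · apply Convex.isPreconnected
      apply (convex_halfSpace_re_lt 0).inter
      intro x hx y hy a b ha hb hab
      change 0 < (ε:ℝ) * x.im at hx
      change 0 < (ε:ℝ) * y.im at hy
      change 0 < (ε:ℝ) * (a • x + b • y).im
      have h3 : (a • x + b • y).im = a * x.im + b * y.im := by simp
      rw [h3]
      have : (ε:ℝ) * (a * x.im + b * y.im) = a * (ε * x.im) + b * (ε * y.im) := by ring
      rw [this]
      exact (convex_Ioi (0:ℝ)) hx hy ha hb hab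
    · have := hne ε hε
      refine ⟨by simp, ?_⟩
      have e : ((ε:ℝ) * (-1 + (ε:ℂ) * Complex.I).im) = ((ε * ε : ℤ) : ℝ) := by simp
      rw [e, this]; norm_num
    · rintro ζ ⟨h1, h2⟩
      refine ⟨hPY h1, fun h3 => ?_⟩
      rw [h3.1] at h2; simp at h2
  have hbase : ∀ ε : ℤ, ε = 1 ∨ ε = -1 → (-1 + ε * Complex.I : ℂ) ∈ Yt \ RzSigT := by
    intro ε hε
    refine ⟨hPY (by simp), fun h => ?_⟩
    have := h.1
    rcases hε with h | h <;> subst h <;> simp at this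
  refine ⟨?_, ?_, ?_⟩
  · intro ε hε
    have hεε := hne ε hε
    have hεR : (ε:ℝ) * ε = 1 := by exact_mod_cast hεε
    refine ⟨hSo.connectedComponentIn, isPreconnected_connectedComponentIn, connectedComponentIn_subset _ _,
      ?_, ⟨_, mem_connectedComponentIn (hbase ε hε)⟩, ?_⟩
    · refine IsPreconnected.subset_closure (s := connectedComponentIn (Yt \ RzSigT) (-1 + ε * Complex.I))
        isPreconnected_connectedComponentIn Set.subset_union_left
        (Set.union_subset subset_closure ?_)
      intro ζ hζ
      apply closure_mono (hquart ε hε)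
      rw [Metric.mem_closure_iff]
      intro δ hδ
      refine ⟨ζ + ((ε * (δ/2) : ℝ) : ℂ) * Complex.I, ⟨?_, ?_⟩, ?_⟩
      · simpa using hζ.2
      · simp [hζ.1]
        have : (ε:ℝ) * (ε * (δ/2)) = δ / 2 := by rw [← mul_assoc, hεR, one_mul]
        rw [this]; linarith
      · rw [dist_eq_norm]
        have e : ζ - (ζ + ((ε * (δ/2) : ℝ) : ℂ) * Complex.I) = -(((ε * (δ/2) : ℝ) : ℂ) * Complex.I) := by ring
        rw [e, norm_neg, norm_mul, Complex.norm_I, mul_one, Complex.norm_real, Real.norm_eq_abs, abs_mul,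
          abs_of_pos (half_pos hδ)]
        have : |(ε:ℝ)| = 1 := by
          rcases hε with h | h <;> subst h <;> simp
        rw [this]; linarith
    · intro ζ hζ
      have hpc : IsPathConnected Yt := (hYto.isConnected_iff_isPathConnected).1 ⟨⟨ζ, hζ⟩, hYtc⟩
      obtain ⟨γ, hγ⟩ := hpc.joinedIn ζ hζ (-1) (hPY (by simp))
      obtain ⟨R, hR⟩ := (isCompact_range (γ.continuous)).isBounded.exists_norm_le
      obtain ⟨J, hJ⟩ := exists_nat_gt R
      refine ⟨J + 1, fun j hj => ?_⟩
      have hj' : R < j ∧ 0 < (j : ℝ) := by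
        have : ((J + 1 : ℕ) : ℝ) ≤ j := by exact_mod_cast hj
        push_cast at this
        have h0 : (0:ℝ) ≤ J := Nat.cast_nonneg J
        constructor <;> linarith
      have him : ∀ z : ℂ, (z + ((ε * j : ℤ) : ℂ) * (2 * Real.pi * Complex.I)).im = z.im + ε * j * (2 * Real.pi) := by
        intro z
        simp
      have hree : ∀ z : ℂ, (z + ((ε * j : ℤ) : ℂ) * (2 * Real.pi * Complex.I)).re = z.re := by
        intro z
        simp
      have h1 : IsPreconnected (Set.range fun t => γ t + ((ε * j : ℤ) : ℂ) * (2 * Real.pi * Complex.I)) := by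
        apply isPreconnected_range
        have := γ.continuous
        fun_prop
      have h2 : (Set.range fun t => γ t + ((ε * j : ℤ) : ℂ) * (2 * Real.pi * Complex.I)) ⊆ Yt \ RzSigT := by
        rintro _ ⟨t, rfl⟩
        refine ⟨?_, fun h => ?_⟩
        · simp only [hYt, Set.mem_preimage]
          rw [rz_exp_period]
          exact hγ t
        · have h3 := h.1
          rw [him] at h3
          have h4 : |(γ t).im| ≤ R := (Complex.abs_im_le_norm _).trans (hR _ ⟨t, rfl⟩)
          have h5 : (γ t).im = - (ε * (j * (2 * Real.pi))) := by linarith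
          have h6 : |(ε:ℝ)| = 1 := by
            rcases hε with h | h <;> subst h <;> simp
          rw [h5, abs_neg, abs_mul, h6, one_mul, abs_of_pos (mul_pos hj'.2 (by positivity))] at h4
          nlinarith [Real.pi_gt_three]
      have h3 : (-1 : ℂ) + ((ε * j : ℤ) : ℂ) * (2 * Real.pi * Complex.I) ∈
          connectedComponentIn (Yt \ RzSigT) (-1 + ε * Complex.I) := by
        apply hquart ε hε
        refine ⟨by rw [hree]; simp, ?_⟩
        rw [him]
        have : (ε:ℝ) * ((-1 : ℂ).im + ε * j * (2 * Real.pi)) = (ε * ε) * (j * (2 * Real.pi)) := by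
          simp; ring
        rw [this, hεR, one_mul]
        have := Real.pi_pos
        have := hj'.2
        positivity
      have h4 := h1.subset_connectedComponentIn ⟨1, by simp only [Path.target]⟩ h2 (x := (-1 : ℂ) + ((ε * j : ℤ) : ℂ) * (2 * Real.pi * Complex.I))
      rw [← connectedComponentIn_eq h3] at h4
      exact h4 ⟨0, by simp only [Path.source]⟩
  · -- cover
    set W := connectedComponentIn (Yt \ RzSigT) (-1 + ((1:ℤ):ℂ) * Complex.I) ∪
      connectedComponentIn (Yt \ RzSigT) (-1 + ((-1:ℤ):ℂ) * Complex.I) with hW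
    have hWo : IsOpen W := hSo.connectedComponentIn.union hSo.connectedComponentIn
    have hBo : IsOpen ((Yt \ RzSigT) \ W) := by
      rw [isOpen_iff_mem_nhds]
      rintro ζ ⟨h1, h2⟩
      refine mem_of_superset ((hSo.connectedComponentIn (x := ζ)).mem_nhds (mem_connectedComponentIn h1)) ?_
      intro z hz
      refine ⟨connectedComponentIn_subset _ _ hz, fun hzC => h2 ?_⟩
      have e1 := connectedComponentIn_eq hz
      rcases hzC with hzC | hzC
      · left
        rw [connectedComponentIn_eq hzC, ← e1]
        exact mem_connectedComponentIn h1
      · right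
        rw [connectedComponentIn_eq hzC, ← e1]
        exact mem_connectedComponentIn h1
    have hPW : ∀ ζ : ℂ, ζ.re < 0 → ζ ∉ RzSigT → ζ ∈ W := by
      intro ζ h1 h2
      have : ζ.im ≠ 0 := fun h => h2 ⟨h, h1⟩
      rcases lt_or_gt_of_ne this with h | h
      · right; apply hquart (-1) (Or.inr rfl); exact ⟨h1, by push_cast; linarith⟩
      · left; apply hquart 1 (Or.inl rfl); exact ⟨h1, by push_cast; linarith⟩
    intro ζ hζ
    by_contra hζW
    have := hYtc (W ∪ {z | z.re < 0}) ((Yt \ RzSigT) \ W)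
      (hWo.union (isOpen_lt Complex.continuous_re continuous_const)) hBo ?_ ⟨-1, hPY (by simp), Or.inr (by simp)⟩
      ⟨ζ, hζ.1, hζ, hζW⟩
    · obtain ⟨z, -, h1, h2⟩ := this
      rcases h1 with h1 | h1
      · exact h2.2 h1
      · exact h2.2 (hPW z h1 h2.1.2)
    · intro z hz
      by_cases hzσ : z ∈ RzSigT
      · left; right; exact hzσ.2
      · by_cases hzW : z ∈ W
        · left; left; exact hzW
        · right; exact ⟨⟨hz, hzσ⟩, hzW⟩
  · intro ζ h1 h2
    have e := connectedComponentIn_eq h1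
    rw [← connectedComponentIn_eq h2] at e
    have hb : (-1 + ((-1:ℤ):ℂ) * Complex.I) ∈ connectedComponentIn (Yt \ RzSigT) (-1 + ((1:ℤ):ℂ) * Complex.I) := by
      rw [e]; exact mem_connectedComponentIn (hbase _ (Or.inr rfl))
    have hpc : IsPathConnected (connectedComponentIn (Yt \ RzSigT) (-1 + ((1:ℤ):ℂ) * Complex.I)) :=
      (hSo.connectedComponentIn.isConnected_iff_isPathConnected).1 ⟨⟨ζ, h1⟩, isPreconnected_connectedComponentIn⟩
    obtain ⟨γ, hγ⟩ := hpc.joinedIn _ (mem_connectedComponentIn (hbase _ (Or.inl rfl))) _ hb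
    have hγ2 : ∀ t, γ t ∈ Yt \ RzSigT := fun t => connectedComponentIn_subset _ _ (hγ t)
    refine rz_no_path (X := Complex.exp ⁻¹' X) (hX.preimage Complex.continuous_exp) (rz_NC_lift hn) (by simpa using h1X)
      ?_ _ _ (by push_cast; ring) (by push_cast; ring) γ ?_ ?_
    · intro s hs
      by_contra! h
      exact hYX _ (hPY h) hs
    · intro t
      exact hYX _ (hγ2 t).1
    · intro t
      have := hγ2 t
      rw [hslit] at this
      exact this.2


theorem rz_sigT_conn : IsPreconnected RzSigT := by
  apply Convex.isPreconnected
  intro x hx y hy a b ha hb hab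
  refine ⟨by simp [hx.1, hy.1], ?_⟩
  have e : (a • x + b • y).re = a * x.re + b * y.re := by simp
  rw [e]
  exact (convex_Iio (0:ℝ)) hx.2 hy.2 ha hb hab

theorem rz_sides_dyn {Y P Q : Set ℂ} (L : ℂ ≃ₜ ℂ) (s : ℤ)
    (hLY : ∀ ζ, Complex.exp (L ζ) ∈ Y ↔ Complex.exp ζ ∈ Y)
    (hLp : ∀ (k : ℤ) ζ, L (ζ + k * (2 * Real.pi * Complex.I)) = L ζ + k * (2 * Real.pi * Complex.I))
    (hσY : RzSigT ⊆ Complex.exp ⁻¹' Y)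
    (hPo : IsOpen P) (hQo : IsOpen Q) (hPQ : ∀ ζ ∈ P, ζ ∉ Q)
    (hP : P ⊆ Complex.exp ⁻¹' Y \ RzSigT) (hQ : Q ⊆ Complex.exp ⁻¹' Y \ RzSigT)
    (hcov : Complex.exp ⁻¹' Y \ RzSigT ⊆ P ∪ Q) (hQσ : IsPreconnected (Q ∪ RzSigT))
    (hQj : ∀ ζ, Complex.exp ζ ∈ Y → ∃ J : ℕ, ∀ j : ℕ, J ≤ j →
        ζ + ((s * j : ℤ) : ℂ) * (2 * Real.pi * Complex.I) ∈ Q)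
    (hLP : L '' RzSigT ⊆ P) :
    ∃ G : Set ℂ, RzSigT ⊆ G ∧ (∀ n ≥ 1, ∀ ζ ∈ RzSigT, L^[n] ζ ∉ G) ∧
      ∀ S : Set ℂ, IsPreconnected S → S ⊆ Complex.exp ⁻¹' Y → (∀ ζ ∈ S, ζ ∉ L '' RzSigT) →
        (S ∩ G).Nonempty → S ⊆ G := by
  have hLo : ∀ {V : Set ℂ}, IsOpen V → IsOpen (L '' V) := fun h => L.isOpenMap _ h
  have hdis : Disjoint (L '' P) (L '' Q) := by
    rw [Set.disjoint_left]
    rintro _ ⟨p, hp, rfl⟩ ⟨q, hq, h⟩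
    exact hPQ p hp (L.injective h ▸ hq)
  have hcov2 : ∀ ζ, Complex.exp ζ ∈ Y → ζ ∉ L '' RzSigT → ζ ∈ L '' P ∪ L '' Q := by
    intro ζ hζ hn
    obtain ⟨z, rfl⟩ := L.surjective ζ
    have hz : z ∈ Complex.exp ⁻¹' Y \ RzSigT := ⟨(hLY z).1 hζ, fun h => hn ⟨z, h, rfl⟩⟩
    rcases hcov hz with h | h
    · left; exact ⟨z, h, rfl⟩
    · right; exact ⟨z, h, rfl⟩
  have hmain : Q ∪ RzSigT ⊆ L '' Q := by
    have h1 : Q ∪ RzSigT ⊆ L '' P ∪ L '' Q := by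
      rintro ζ (h | h)
      · refine hcov2 ζ (hQ h).1 fun h2 => hPQ ζ (hLP h2) h
      · refine hcov2 ζ (hσY h) fun h2 => (hP (hLP h2)).2 h
    rcases isPreconnected_iff_subset_of_disjoint.1 hQσ _ _ (hLo hPo) (hLo hQo) h1
      (by rw [hdis.inter_eq, Set.inter_empty]) with h | h
    · exfalso
      have hm : (-1 : ℂ) ∈ RzSigT := ⟨by simp, by simp⟩
      obtain ⟨J1, hJ1⟩ := hQj (-1) (hσY hm)
      obtain ⟨J2, hJ2⟩ := hQj (L (-1)) ((hLY _).2 (hσY hm))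
      have e1 := hJ1 (max J1 J2) (le_max_left _ _)
      have e2 := hJ2 (max J1 J2) (le_max_right _ _)
      rw [← hLp] at e2
      obtain ⟨p, hp, hpe⟩ := h (Or.inl e2)
      rw [L.injective hpe] at hp
      exact hPQ _ hp e1
    · exact h
  refine ⟨L '' Q, fun ζ h => hmain (Or.inr h), ?_, ?_⟩
  · intro n hn
    induction n, hn using Nat.le_induction with
    | base =>
      rintro ζ hζ ⟨q, hq, h⟩
      simp only [Function.iterate_one] at h
      rw [L.injective h] at hq
      exact (hQ hq).2 hζ
    | succ n hn ih =>
      rintro ζ hζ ⟨q, hq, h⟩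
      rw [Function.iterate_succ_apply'] at h
      rw [L.injective h] at hq
      exact ih ζ hζ (hmain (Or.inl hq))
  · intro S hS hSY hSn hne
    have h1 : S ⊆ L '' P ∪ L '' Q := fun ζ h => hcov2 ζ (hSY h) (hSn ζ h)
    rcases isPreconnected_iff_subset_of_disjoint.1 hS _ _ (hLo hPo) (hLo hQo) h1
      (by rw [hdis.inter_eq, Set.inter_empty]) with h | h
    · obtain ⟨z, h2, h3⟩ := hne
      exact absurd h3 (Set.disjoint_left.1 hdis (h h2))
    · exact h

theorem rz_periodic_log {v : ℂ → ℂ} (hv : Continuous v)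
    (hp : ∀ (k : ℤ) ζ, v (ζ + k * (2 * Real.pi * Complex.I)) = v ζ) {w0 : ℂ} (h0 : w0 ≠ 0) :
    ContinuousAt (fun w => v (Complex.log w)) w0 := by
  have h1 : (fun w => v (Complex.log (w / w0) + Complex.log w0)) =ᶠ[𝓝 w0] fun w => v (Complex.log w) := by
    filter_upwards [isOpen_ne.mem_nhds h0] with w hw
    have : Complex.exp (Complex.log (w / w0) + Complex.log w0) = Complex.exp (Complex.log w) := by
      rw [Complex.exp_add, Complex.exp_log h0, Complex.exp_log hw, Complex.exp_log (div_ne_zero hw h0),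
        div_mul_cancel₀ _ h0]
    obtain ⟨k, hk⟩ := Complex.exp_eq_exp_iff_exists_int.1 this
    rw [hk, hp]
  refine ContinuousAt.congr ?_ h1
  apply hv.continuousAt.comp
  apply ContinuousAt.add _ continuousAt_const
  apply ContinuousAt.clog
  · exact continuousAt_id.div_const w0
  · simp [div_self h0]

theorem rz_core (F : ℂ ≃ₜ ℂ) {C : ℝ} (hb : ∀ z, ‖F z - z‖ ≤ C)
    (hr : ∀ ε > 0, ∀ m : ℕ, ∃ n ≥ m, ∀ z, ‖F^[n] z - z‖ < ε)
    {X : Set ℂ} (hX : IsClosed X) (hn : RzNC X) (hXi : ∀ w, F w ∈ X ↔ w ∈ X)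
    (hdX : ∀ w ∈ ball (0:ℂ) 1, w ∉ X) (h1X : (1:ℂ) ∈ X)
    (hfree : ∀ w ∈ closedBall (0:ℂ) 1, F w ∉ closedBall (0:ℂ) 1)
    (hF0 : F 0 ∈ connectedComponentIn Xᶜ 0) : False := by
  obtain ⟨Y, hYd⟩ : ∃ Y, Y = connectedComponentIn Xᶜ (0:ℂ) := ⟨_, rfl⟩
  obtain ⟨hFY, hdY, H, C', U, hHb, hH0, hHY, hUo, hXU, hHU, hHσ⟩ :=
    rz_stage1 F hb hX hXi hdX h1X hfree hYd (hYd ▸ hF0)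
  obtain ⟨L, hLe, hLp, hLR⟩ := rz_lift_homeo H hH0 hHb
  have hYo : IsOpen Y := hYd ▸ hX.isOpen_compl.connectedComponentIn
  have hYc : IsPreconnected Y := hYd ▸ isPreconnected_connectedComponentIn
  have hYX : ∀ y ∈ Y, y ∉ X := by
    intro y hy
    rw [hYd] at hy
    exact connectedComponentIn_subset _ _ hy
  obtain ⟨-, hσY, A, hA, hcov, hdis⟩ := rz_sides hX hn h1X hYo hYc hdY hYX
  have hLY : ∀ ζ, Complex.exp (L ζ) ∈ Y ↔ Complex.exp ζ ∈ Y := by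
    intro ζ; rw [hLe]; exact hHY _
  have hLσ : L '' RzSigT ⊆ Complex.exp ⁻¹' Y \ RzSigT := by
    rintro _ ⟨ζ, hζ, rfl⟩
    refine ⟨(hLY ζ).2 (hσY hζ), fun h => ?_⟩
    have e : ζ = (ζ.re : ℂ) := Complex.ext rfl (by simp [hζ.1])
    have e2 : L ζ = ((L ζ).re : ℂ) := Complex.ext rfl (by simp [h.1])
    refine hHσ (Real.exp ζ.re) (Real.exp_pos _) (Real.exp_lt_one_iff.2 hζ.2) ?_
    have h3 := hLe ζ
    rw [e2] at h3
    have e3 : Complex.exp ζ = ((Real.exp ζ.re : ℝ) : ℂ) := by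
      rw [Complex.ofReal_exp, ← e]
    rw [e3] at h3
    rw [← h3, ← Complex.ofReal_exp]
    exact ⟨Complex.ofReal_im _, by rw [Complex.ofReal_re]; exact (Real.exp_pos _).le,
      by rw [Complex.ofReal_re]; exact Real.exp_lt_one_iff.2 h.2⟩
  obtain ⟨G, hσG, hGn, hGS⟩ : ∃ G : Set ℂ, RzSigT ⊆ G ∧ (∀ n ≥ 1, ∀ ζ ∈ RzSigT, L^[n] ζ ∉ G) ∧
      ∀ S : Set ℂ, IsPreconnected S → S ⊆ Complex.exp ⁻¹' Y → (∀ ζ ∈ S, ζ ∉ L '' RzSigT) →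
        (S ∩ G).Nonempty → S ⊆ G := by
    obtain ⟨o1, -, s1, c1, -, j1⟩ := hA 1 (Or.inl rfl)
    obtain ⟨o2, -, s2, c2, -, j2⟩ := hA (-1) (Or.inr rfl)
    have hLc : IsPreconnected (L '' RzSigT) := rz_sigT_conn.image _ L.continuous.continuousOn
    have hd : Disjoint (A 1) (A (-1)) := Set.disjoint_left.2 hdis
    rcases isPreconnected_iff_subset_of_disjoint.1 hLc _ _ o1 o2 (hLσ.trans hcov)
      (by rw [hd.inter_eq, Set.inter_empty]) with h | h
    · exact rz_sides_dyn L (-1) hLY hLp hσY o1 o2 hdis s1 s2 hcov c2 j2 h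
    · exact rz_sides_dyn L 1 hLY hLp hσY o2 o1 (fun ζ h1 h2 => hdis ζ h2 h1) s2 s1
        (hcov.trans (Set.union_comm _ _).subset) c1 j1 h
  -- the small ball
  obtain ⟨η, hη, hη2, hηL⟩ : ∃ η : ℝ, 0 < η ∧ η ≤ 1 / 2 ∧ ∀ ζ ∈ ball (0:ℂ) (2 * η), ζ ∉ L '' RzSigT := by
    have hc : IsClosed (L '' {ζ : ℂ | ζ.im = 0 ∧ ζ.re ≤ 0}) := by
      apply L.isClosedMap
      exact (isClosed_eq Complex.continuous_im continuous_const).inter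
        (isClosed_le Complex.continuous_re continuous_const)
    have h0 : (0:ℂ) ∉ L '' {ζ : ℂ | ζ.im = 0 ∧ ζ.re ≤ 0} := by
      rintro ⟨ζ, ⟨h1, h2⟩, h3⟩
      have h4 := hLe ζ
      rw [h3, Complex.exp_zero] at h4
      rcases h2.lt_or_eq with h2 | h2
      · have : Complex.exp ζ ∈ Y := hσY ⟨h1, h2⟩
        exact hYX 1 (h4 ▸ (hHY _).2 this) h1X
      · have : ζ = 0 := Complex.ext h2 h1
        rw [this, Complex.exp_zero, hHU 1 (hXU h1X)] at h4
        exact hfree 1 (by simp) (by rw [← h4]; simp)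
    obtain ⟨r, hr0, hrr⟩ := Metric.isOpen_iff.1 hc.isOpen_compl 0 h0
    refine ⟨min (r / 2) (1 / 2), by positivity, min_le_right _ _, fun ζ hζ h => ?_⟩
    refine hrr (ball_subset_ball ?_ hζ) ?_
    · have := min_le_left (r / 2) (1 / 2 : ℝ); linarith
    · obtain ⟨z, hz, rfl⟩ := h
      exact ⟨z, ⟨hz.1, hz.2.le⟩, rfl⟩
  obtain ⟨δ, hδ, hδ1, hδη⟩ : ∃ δ : ℝ, 0 < δ ∧ δ ≤ 1 ∧ ∀ z : ℂ, ‖z - 1‖ < δ → ‖Complex.log z‖ < η := by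
    have hc : ContinuousAt Complex.log 1 := continuousAt_clog (by simp)
    obtain ⟨δ, h1, h2⟩ := Metric.continuousAt_iff.1 hc η hη
    refine ⟨min δ 1, by positivity, min_le_right _ _, fun z hz => ?_⟩
    have := h2 (x := z) (by rw [dist_eq_norm]; exact lt_of_lt_of_le hz (min_le_left _ _))
    simpa [dist_eq_norm] using this
  obtain ⟨n, hn1, hnF⟩ := hr (δ / 2) (by positivity) 1
  have hq : ∀ w : ℂ, 1 / 2 ≤ ‖w‖ → ‖F^[n] w / w - 1‖ < δ := by
    intro w hw
    have hw0 : w ≠ 0 := by rintro rfl; simp at hw; linarith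
    have h1 : F^[n] w / w - 1 = (F^[n] w - w) / w := by rw [sub_div, div_self hw0]
    rw [h1, norm_div, div_lt_iff₀ (by linarith)]
    have := hnF w
    nlinarith
  have hqs : ∀ w : ℂ, 1 / 2 ≤ ‖w‖ → F^[n] w / w ∈ Complex.slitPlane := fun w hw =>
    rz_slit (lt_of_lt_of_le (hq w hw) hδ1)
  have hFc : Continuous (F^[n]) := F.continuous.iterate n
  set lam : ℂ → ℂ := fun w => Complex.log (F^[n] w / w) with hlam
  have hlc : ContinuousOn lam {w | 1 / 2 ≤ ‖w‖} := by
    apply ContinuousOn.clog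
    · apply ContinuousOn.div hFc.continuousOn continuousOn_id
      rintro w hw rfl
      change (1/2 : ℝ) ≤ ‖(0:ℂ)‖ at hw
      simp at hw; linarith
    · exact hqs
  have hlη : ∀ w : ℂ, 1 / 2 ≤ ‖w‖ → ‖lam w‖ < η := fun w hw => hδη _ (hq w hw)
  have hle : ∀ w : ℂ, 1 / 2 ≤ ‖w‖ → ∀ ζ, Complex.exp ζ = w → Complex.exp (ζ + lam w) = F^[n] w := by
    intro w hw ζ hζ
    have hw0 : w ≠ 0 := by rintro rfl; simp at hw; linarith
    rw [Complex.exp_add, hζ, hlam, Complex.exp_log (Complex.slitPlane_ne_zero (hqs w hw)), mul_div_cancel₀ _ hw0]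
  have hFnY : ∀ w, w ∈ Y → F^[n] w ∈ Y := by
    intro w hw
    clear hn1 hnF hq hqs hFc hlc hlη hle lam hlam
    induction n with
    | zero => exact hw
    | succ n ih => rw [Function.iterate_succ_apply']; exact (hFY _).2 ih
  -- the curve c
  set c : ℝ → ℂ := fun t => t + lam (Complex.exp t) with hc
  have hexp : ∀ t : ℝ, -η ≤ t → 1 / 2 ≤ ‖Complex.exp (t:ℂ)‖ := by
    intro t ht
    rw [Complex.norm_exp, Complex.ofReal_re]
    have := Real.add_one_le_exp t
    linarith
  have hcc : ContinuousOn c (Set.Icc (-η) 0) := by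
    apply ContinuousOn.add (by fun_prop)
    apply hlc.comp (by fun_prop)
    intro t ht
    exact hexp t ht.1
  have hce : ∀ t : ℝ, -η ≤ t → Complex.exp (c t) = F^[n] (Complex.exp t) := by
    intro t ht
    exact hle _ (hexp t ht) _ rfl
  have hcη : ∀ t : ℝ, -η ≤ t → ‖c t - t‖ < η := by
    intro t ht
    simp only [hc, add_sub_cancel_left]
    exact hlη _ (hexp t ht)
  have hηre : ∀ ζ ∈ ball (-(η:ℂ)) η, ζ.re < 0 := by
    intro ζ hζ
    rw [mem_ball, dist_eq_norm] at hζ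
    have := (Complex.abs_re_le_norm (ζ - -(η:ℂ))).trans_lt hζ
    rw [abs_lt] at this
    simp at this
    linarith [this.2]
  have hcG : ∀ t : ℝ, -η ≤ t → t < 0 → c t ∈ G := by
    have hS : c '' Set.Ico (-η) 0 ∪ ball (-(η:ℂ)) η ⊆ G := by
      apply hGS
      · refine IsPreconnected.union (c (-η)) ⟨-η, ⟨le_rfl, by linarith⟩, rfl⟩ ?_ ?_ ?_
        · rw [mem_ball, dist_eq_norm]
          have := hcη (-η) le_rfl
          push_cast at this
          exact this
        · exact isPreconnected_Ico.image _ (hcc.mono Set.Ico_subset_Icc_self)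
        · exact (convex_ball _ _).isPreconnected
      · rintro ζ (⟨t, ht, rfl⟩ | h)
        · rw [Set.mem_preimage, hce t ht.1]
          apply hFnY
          apply hdY
          rw [mem_ball_zero_iff, Complex.norm_exp, Complex.ofReal_re, Real.exp_lt_one_iff]
          exact ht.2
        · rw [Set.mem_preimage]
          apply hdY
          rw [mem_ball_zero_iff, Complex.norm_exp, Real.exp_lt_one_iff]
          exact hηre ζ h
      · rintro ζ (⟨t, ht, rfl⟩ | h)
        · apply hηL
          rw [mem_ball_zero_iff]
          have h1 := hcη t ht.1
          have h2 : ‖c t‖ ≤ ‖c t - t‖ + ‖(t:ℂ)‖ := by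
            simpa using norm_add_le (c t - t) (t:ℂ)
          have h3 : ‖(t:ℂ)‖ ≤ η := by
            rw [Complex.norm_real, Real.norm_eq_abs, abs_le]
            exact ⟨ht.1, by linarith [ht.2]⟩
          linarith
        · apply hηL
          rw [mem_ball, dist_eq_norm] at h
          rw [mem_ball_zero_iff]
          have h2 : ‖ζ‖ ≤ ‖ζ - -(η:ℂ)‖ + ‖-(η:ℂ)‖ := by
            simpa using norm_add_le (ζ - -(η:ℂ)) (-(η:ℂ))
          have h3 : ‖-(η:ℂ)‖ = η := by
            rw [norm_neg, Complex.norm_real, Real.norm_eq_abs, abs_of_pos hη]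
          linarith
      · refine ⟨-(η:ℂ), Or.inr (mem_ball_self hη), hσG ⟨by simp, by simpa using hη⟩⟩
    intro t h1 h2
    exact hS (Or.inl ⟨t, ⟨h1, h2⟩, rfl⟩)
  -- iterates
  have hLn : ∀ (k : ℕ) ζ, Complex.exp (L^[k] ζ) = H^[k] (Complex.exp ζ) := by
    intro k
    induction k with
    | zero => intro ζ; rfl
    | succ k ih => intro ζ; rw [Function.iterate_succ_apply', Function.iterate_succ_apply', hLe, ih]
  have hLnp : ∀ (j : ℕ) (k : ℤ) ζ, L^[j] (ζ + k * (2 * Real.pi * Complex.I)) = L^[j] ζ + k * (2 * Real.pi * Complex.I) := by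
    intro j k
    induction j with
    | zero => intro ζ; rfl
    | succ j ih => intro ζ; rw [Function.iterate_succ_apply', Function.iterate_succ_apply', ih, hLp]
  have hHF : ∀ (k : ℕ), ∀ x ∈ X, ∀ᶠ w in 𝓝 x, H^[k] w = F^[k] w := by
    intro k
    induction k with
    | zero => intro x _; exact Eventually.of_forall fun _ => rfl
    | succ k ih =>
      intro x hx
      have h1 := F.continuous.continuousAt.eventually (ih (F x) ((hXi x).2 hx))
      filter_upwards [h1, hUo.mem_nhds (hXU hx)] with w h2 h3
      rw [Function.iterate_succ_apply, Function.iterate_succ_apply, hHU w h3, h2]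
  have hX1 : ∀ w ∈ X, 1 ≤ ‖w‖ := by
    intro w hw
    by_contra! h
    exact hdX w (by simpa using h) hw
  have hXh : ∀ w ∈ X, 1 / 2 ≤ ‖w‖ := fun w hw => by linarith [hX1 w hw]
  have hX0 : ∀ w ∈ X, w ≠ 0 := by
    rintro w hw rfl
    have := hX1 0 hw
    simp at this
    linarith
  have hLnc : Continuous (L^[n]) := L.continuous.iterate n
  have hu : L^[n] (Complex.log 1) - Complex.log 1 - lam 1 = 0 := by
    obtain ⟨R, hR⟩ := hLR n 1 one_pos
    have hintk : ∀ w ∈ X, ∃ k : ℤ, L^[n] (Complex.log w) - Complex.log w - lam w = k * (2 * Real.pi * Complex.I) := by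
      intro w hw
      have h1 : Complex.exp (L^[n] (Complex.log w)) = Complex.exp (Complex.log w + lam w) := by
        rw [hLn, Complex.exp_log (hX0 w hw), hle w (hXh w hw) _ (Complex.exp_log (hX0 w hw))]
        exact (hHF n w hw).self_of_nhds
      obtain ⟨k, hk⟩ := rz_log_diff h1
      exact ⟨k, by rw [← hk]; ring⟩
    refine rz_NC_zero hX hn (u := fun w => L^[n] (Complex.log w) - Complex.log w - lam w) (R := Real.exp R) ?_ hintk ?_ h1X
    · apply ContinuousOn.sub
      · intro w hw
        apply ContinuousAt.continuousWithinAt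
        refine rz_periodic_log (v := fun ζ => L^[n] ζ - ζ) (by fun_prop) ?_ (hX0 w hw)
        intro k ζ
        rw [hLnp]; ring
      · exact hlc.mono hXh
    · intro w hw hwR
      apply rz_int_close (hintk w hw)
      have h1 := hR (Complex.log w) (by
        rw [Complex.log_re, Real.lt_log_iff_exp_lt (norm_pos_iff.2 (hX0 w hw))]; exact hwR)
      have h2 := hlη w (hXh w hw)
      have h3 := norm_sub_le (L^[n] (Complex.log w) - Complex.log w) (lam w)
      linarith [Real.pi_gt_three]
  rw [Complex.log_one] at hu
  have hL0 : L^[n] 0 = c 0 := by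
    simp only [hc, Complex.ofReal_zero, Complex.exp_zero, zero_add]
    linear_combination hu
  obtain ⟨r, hr0, hrη, hrr⟩ : ∃ r : ℝ, 0 < r ∧ r ≤ η ∧ ∀ t : ℝ, |t| ≤ r → H^[n] (Complex.exp t) = F^[n] (Complex.exp t) := by
    have h1 := hHF n 1 h1X
    have hct : Continuous fun t : ℝ => Complex.exp t := by fun_prop
    have h2 : ∀ᶠ t : ℝ in 𝓝 0, H^[n] (Complex.exp t) = F^[n] (Complex.exp t) := by
      refine (hct.continuousAt (x := 0)).eventually (p := fun w => H^[n] w = F^[n] w) ?_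
      simpa using h1
    obtain ⟨r, h3, h4⟩ := Metric.eventually_nhds_iff.1 h2
    refine ⟨min (r / 2) η, by positivity, min_le_right _ _, fun t ht => h4 ?_⟩
    rw [Real.dist_eq, sub_zero]
    have := min_le_left (r / 2) η
    linarith
  have key := rz_log_unique (s := Set.Icc (-r) 0) (l := fun t : ℝ => L^[n] (t:ℂ)) (m := c)
    isPreconnected_Icc (by fun_prop) (hcc.mono (Set.Icc_subset_Icc_left (by linarith)))
    (by
      intro t ht
      rw [hLn, hce t (by linarith [ht.1])]
      apply hrr
      rw [abs_le]
      exact ⟨ht.1, by linarith [ht.2]⟩) (x := 0) (y := -r) ⟨by linarith, le_rfl⟩ ⟨le_rfl, by linarith⟩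
    (by simpa using hL0)
  refine hGn n hn1 ((-r : ℝ) : ℂ) ⟨by simp, by simpa using hr0⟩ ?_
  rw [key]
  exact hcG (-r) (by linarith) (by linarith)


theorem rz_core_affine (F : ℂ ≃ₜ ℂ) {C : ℝ} (hb : ∀ z, ‖F z - z‖ ≤ C)
    (hr : ∀ ε > 0, ∀ m : ℕ, ∃ n ≥ m, ∀ z, ‖F^[n] z - z‖ < ε)
    {X : Set ℂ} (hX : IsClosed X) (hn : RzNC X) (hXi : ∀ w, F w ∈ X ↔ w ∈ X)
    {q x : ℂ} (hxq : x - q ≠ 0)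
    (hdX : ∀ w ∈ ball q ‖x - q‖, w ∉ X) (h1X : x ∈ X)
    (hfree : ∀ w ∈ closedBall q ‖x - q‖, F w ∉ closedBall q ‖x - q‖)
    (hF0 : F q ∈ connectedComponentIn Xᶜ q) : False := by
  set k := x - q with hk
  have hk0 : 0 < ‖k‖ := norm_pos_iff.2 hxq
  obtain ⟨a, ha⟩ : ∃ a : ℂ ≃ₜ ℂ, ∀ w, a w = q + k * w :=
    ⟨(Homeomorph.mulLeft₀ k hxq).trans (Homeomorph.addLeft q), fun w => rfl⟩
  have hdist : ∀ u v, ‖a u - a v‖ = ‖k‖ * ‖u - v‖ := by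
    intro u v
    rw [ha, ha, add_sub_add_left_eq_sub, ← mul_sub, norm_mul]
  have ha0 : a 0 = q := by rw [ha]; simp
  have ha1 : a 1 = x := by rw [ha, hk]; ring
  obtain ⟨F2, hF2⟩ : ∃ F2 : ℂ ≃ₜ ℂ, ∀ w, a (F2 w) = F (a w) :=
    ⟨a.trans (F.trans a.symm), fun w => by simp⟩
  have hit : ∀ (n : ℕ) w, a (F2^[n] w) = F^[n] (a w) := by
    intro n
    induction n with
    | zero => intro w; rfl
    | succ n ih => intro w; rw [Function.iterate_succ_apply', Function.iterate_succ_apply', hF2, ih]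
  have hball : ∀ w, w ∈ closedBall (0:ℂ) 1 ↔ a w ∈ closedBall q ‖k‖ := by
    intro w
    rw [mem_closedBall, mem_closedBall, dist_eq_norm, dist_eq_norm]
    nth_rewrite 1 [← ha0]
    rw [hdist, mul_le_iff_le_one_right hk0]
  refine rz_core F2 (C := C / ‖k‖) ?_ ?_ (X := a ⁻¹' X) (hX.preimage a.continuous) ?_ ?_ ?_ ?_ ?_ ?_
  · intro z
    rw [le_div_iff₀ hk0, mul_comm, ← hdist, hF2]
    exact hb _
  · intro ε hε m
    obtain ⟨n, h1, h2⟩ := hr (‖k‖ * ε) (by positivity) m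
    refine ⟨n, h1, fun z => ?_⟩
    have := h2 (a z)
    rw [← hit, hdist] at this
    exact lt_of_mul_lt_mul_left this hk0.le
  · intro O hO hc
    have h1 : a '' (a ⁻¹' X ∩ O) = X ∩ a '' O := by
      ext w
      constructor
      · rintro ⟨ζ, ⟨h1, h2⟩, rfl⟩
        exact ⟨h1, ζ, h2, rfl⟩
      · rintro ⟨h1, ζ, h2, rfl⟩
        exact ⟨ζ, ⟨h1, h2⟩, rfl⟩
    have h2 := hn (a '' O) (a.isOpenMap O hO) (h1 ▸ hc.image a.continuous)
    rw [← h1] at h2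
    simpa using h2
  · intro w
    rw [Set.mem_preimage, Set.mem_preimage, hF2, hXi]
  · intro w hw
    apply hdX
    rw [mem_ball, dist_eq_norm] at hw ⊢
    rw [← ha0, hdist]
    nlinarith
  · rw [Set.mem_preimage, ha1]; exact h1X
  · intro w hw
    rw [hball, hF2]
    exact hfree _ ((hball w).1 hw)
  · have hq : q ∈ Xᶜ := hdX q (mem_ball_self hk0)
    have h1 := a.symm.image_connectedComponentIn hq
    have h2 : a.symm '' Xᶜ = (a ⁻¹' X)ᶜ := by
      rw [← Set.preimage_compl]
      exact a.toEquiv.symm.image_eq_preimage_symm _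
    rw [h2] at h1
    have h3 : a.symm q = 0 := by rw [← ha0, a.symm_apply_apply]
    rw [h3] at h1
    rw [← h1]
    refine ⟨F q, hF0, ?_⟩
    rw [← ha0, ← hF2, a.symm_apply_apply]

theorem rz_comp_eq_of_mem {V : Set ℂ} {a b c : ℂ} (h1 : c ∈ connectedComponentIn V a)
    (h2 : c ∈ connectedComponentIn V b) : connectedComponentIn V a = connectedComponentIn V b := by
  rw [connectedComponentIn_eq h1, connectedComponentIn_eq h2]

theorem rz_image_comp (F : ℂ ≃ₜ ℂ) {U : Set ℂ} (hU : ∀ w, F w ∈ U ↔ w ∈ U) {q : ℂ} (hq : q ∈ U) :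
    F '' connectedComponentIn U q = connectedComponentIn U (F q) := by
  rw [F.image_connectedComponentIn hq]
  congr 1
  ext x
  constructor
  · rintro ⟨y, hy, rfl⟩; exact (hU y).2 hy
  · intro hx
    obtain ⟨y, rfl⟩ := F.surjective x
    exact ⟨y, (hU y).1 hx, rfl⟩

/-- recurrent plane homeomorphisms with bounded displacement are trivial -/
theorem rz_plane (F : ℂ ≃ₜ ℂ) {C : ℝ} (hb : ∀ z, ‖F z - z‖ ≤ C)
    (hr : ∀ ε > 0, ∀ m : ℕ, ∃ n ≥ m, ∀ z, ‖F^[n] z - z‖ < ε) : ∀ z, F z = z := by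
  classical
  by_contra! hz
  obtain ⟨z, hz⟩ := hz
  obtain ⟨U, hUd⟩ : ∃ U : Set ℂ, U = {w | F w ≠ w} := ⟨_, rfl⟩
  have hUo : IsOpen U := by rw [hUd]; exact isOpen_ne_fun F.continuous continuous_id
  have hUm : ∀ w, w ∈ U ↔ F w ≠ w := by intro w; rw [hUd]; rfl
  have hUF : ∀ w, F w ∈ U ↔ w ∈ U := by
    intro w; rw [hUm, hUm, F.injective.ne_iff]
  have hzU : z ∈ U := (hUm z).2 hz
  set V := connectedComponentIn U z with hV
  have hVo : IsOpen V := hUo.connectedComponentIn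
  have hzV : z ∈ V := mem_connectedComponentIn hzU
  have hVU : V ⊆ U := connectedComponentIn_subset _ _
  have hFV : F '' V = connectedComponentIn U (F z) := rz_image_comp F hUF hzU
  have hFzV : F z ∈ V := by
    by_contra hFz
    have hdis : ∀ w ∈ V, F w ∉ V := by
      intro w hw hFw
      apply hFz
      have h1 : F w ∈ connectedComponentIn U (F z) := hFV ▸ ⟨w, hw, rfl⟩
      rw [hV, rz_comp_eq_of_mem hFw h1]
      exact mem_connectedComponentIn ((hUF z).2 hzU)
    have hfr : ∀ w ∈ frontier V, F w = w := by
      intro w hw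
      by_contra hne
      have hwU : w ∈ U := (hUm w).2 hne
      have hwV : w ∉ V := by
        rw [hVo.frontier_eq] at hw; exact hw.2
      obtain ⟨y, hy1, hy2⟩ := mem_closure_iff.1 (frontier_subset_closure hw) _ (hUo.connectedComponentIn (x := w))
        (mem_connectedComponentIn hwU)
      apply hwV
      rw [hV, rz_comp_eq_of_mem hy2 hy1]
      exact mem_connectedComponentIn hwU
    have hc : Continuous fun w => if w ∈ V then F w else w :=
      Continuous.if hfr F.continuous continuous_id
    have hC0 : 0 ≤ C := (norm_nonneg _).trans (hb 0)
    obtain ⟨w, hw⟩ := rz_surj hc (C := C) (by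
      intro w
      by_cases h : w ∈ V
      · simp only [h, if_true]; exact hb w
      · simp only [h, if_false, sub_self, norm_zero]; exact hC0) z
    by_cases h : w ∈ V
    · simp only [h, if_true] at hw
      exact hdis w h (hw ▸ hzV)
    · simp only [h, if_false] at hw
      exact h (hw ▸ hzV)
  have hpc : IsPathConnected V := (hVo.isConnected_iff_isPathConnected).1 ⟨⟨z, hzV⟩, isPreconnected_connectedComponentIn⟩
  obtain ⟨γ, hγ⟩ := hpc.joinedIn z hzV (F z) hFzV
  set Pa := Set.range γ with hPa
  have hPac : IsCompact Pa := isCompact_range γ.continuous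
  have hPap : IsPreconnected Pa := isPreconnected_range γ.continuous
  have hPaV : Pa ⊆ V := by rintro _ ⟨t, rfl⟩; exact hγ t
  have hzPa : z ∈ Pa := ⟨0, γ.source⟩
  have hFzPa : F z ∈ Pa := ⟨1, γ.target⟩
  obtain ⟨r, hr0, hrV⟩ := hPac.exists_cthickening_subset_open hVo hPaV
  obtain ⟨X, hX, hXn, hXi, hXN, x, hxX, hxN⟩ := rz_growth F hr (N := thickening r Pa) isOpen_thickening
    ⟨z, self_subset_thickening hr0 _ hzPa⟩ hPac.isBounded.thickening
  have hxc : x ∈ cthickening r Pa := closure_thickening_subset_cthickening _ _ hxN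
  obtain ⟨c, hcPa, hc⟩ := hPac.exists_infDist_eq_dist ⟨z, hzPa⟩ x
  have hcr : dist x c ≤ r := by
    rw [← hc]
    exact (hPac.cthickening_eq_biUnion_closedBall hr0.le ▸ hxc : x ∈ ⋃ y ∈ Pa, closedBall y r) |> fun h => by
      simp only [Set.mem_iUnion] at h
      obtain ⟨y, hy, hxy⟩ := h
      exact (infDist_le_dist_of_mem hy).trans hxy
  have hbN : ball c r ⊆ thickening r Pa := ball_subset_thickening hcPa r
  have hcr2 : dist x c = r := by
    refine le_antisymm hcr ?_
    by_contra! h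
    exact hXN x hxX (hbN h)
  have hxF : F x ≠ x := (hUm x).1 (hVU (hrV hxc))
  obtain ⟨ρ, hρ, hρF⟩ : ∃ ρ > 0, ∀ w ∈ closedBall x ρ, F w ∉ closedBall x ρ := by
    have hd : 0 < dist (F x) x := dist_pos.2 hxF
    obtain ⟨ρ, h1, h2⟩ := Metric.continuousAt_iff.1 (F.continuous.continuousAt (x := x)) (dist (F x) x / 3) (by positivity)
    refine ⟨min (ρ / 2) (dist (F x) x / 3), by positivity, fun w hw hFw => ?_⟩
    rw [mem_closedBall] at hw hFw
    have h3 := h2 (x := w) (lt_of_le_of_lt (hw.trans (min_le_left _ _)) (by linarith))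
    have h4 := hFw.trans (min_le_right _ _)
    have h5 := dist_triangle_left (F x) x (F w)
    linarith
  obtain ⟨s, hs0, hs1, hsρ⟩ : ∃ s : ℝ, 0 < s ∧ s ≤ 1 ∧ s * r * 2 ≤ ρ := by
    refine ⟨min 1 (ρ / (2 * r)), by positivity, min_le_left _ _, ?_⟩
    have := min_le_right 1 (ρ / (2 * r))
    rw [le_div_iff₀ (by positivity)] at this
    linarith
  obtain ⟨q, hq⟩ : ∃ q : ℂ, q = x + s * (c - x) := ⟨_, rfl⟩
  have hxq : ‖x - q‖ = s * r := by
    have : x - q = s * (x - c) := by rw [hq]; ring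
    rw [this, norm_mul, Complex.norm_real, Real.norm_of_nonneg hs0.le, ← dist_eq_norm, hcr2]
  have hqc : dist q c = (1 - s) * r := by
    have : q - c = ((1 - s : ℝ) : ℂ) * (x - c) := by rw [hq]; push_cast; ring
    rw [dist_eq_norm, this, norm_mul, Complex.norm_real, Real.norm_of_nonneg (by linarith), ← dist_eq_norm, hcr2]
  have hsr : 0 < s * r := by positivity
  have hqb : ball q ‖x - q‖ ⊆ ball c r := by
    rw [hxq]
    apply ball_subset_ball'
    rw [hqc]; linarith
  have hqx : closedBall q ‖x - q‖ ⊆ closedBall x ρ := by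
    apply closedBall_subset_closedBall'
    rw [dist_comm, dist_eq_norm, hxq]; linarith
  refine rz_core_affine F hb hr hX hXn hXi (q := q) (x := x) ?_ ?_ hxX ?_ ?_
  · rw [← norm_pos_iff, hxq]; exact hsr
  · intro w hw hwX
    exact hXN w hwX (hbN (hqb hw))
  · intro w hw hFw
    exact hρF w (hqx hw) (hqx hFw)
  · have hqball : q ∈ ball c r := hqb (mem_ball_self (by rw [hxq]; exact hsr))
    have hNX : thickening r Pa ⊆ Xᶜ := fun w hw hwX => hXN w hwX hw
    have hpre : IsPreconnected (ball c r ∪ Pa) :=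
      IsPreconnected.union c (mem_ball_self hr0) hcPa (convex_ball _ _).isPreconnected hPap
    have hsub : ball c r ∪ Pa ⊆ Xᶜ := (Set.union_subset hbN (self_subset_thickening hr0 _)).trans hNX
    have hK := hpre.subset_connectedComponentIn (Or.inl hqball) hsub
    have hXcF : ∀ w, F w ∈ Xᶜ ↔ w ∈ Xᶜ := fun w => not_congr (hXi w)
    have hqX : q ∈ Xᶜ := hsub (Or.inl hqball)
    have h1 := rz_image_comp F hXcF hqX
    have h2 : F z ∈ connectedComponentIn Xᶜ (F q) := h1 ▸ ⟨z, hK (Or.inr hzPa), rfl⟩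
    rw [rz_comp_eq_of_mem (hK (Or.inr hFzPa)) h2]
    exact mem_connectedComponentIn ((hXcF q).2 hqX)


theorem rz_iter_dist {M : Type*} [MetricSpace M] {h : M → M} {ε : ℝ} (hh : ∀ x, dist (h x) x < ε) (m : ℕ) :
    ∀ x, dist (h^[m] x) x ≤ m * ε := by
  induction m with
  | zero => intro x; simp
  | succ m ih =>
    intro x
    rw [Function.iterate_succ_apply']
    have h1 := dist_triangle (h (h^[m] x)) (h^[m] x) x
    have h2 := hh (h^[m] x)
    have h3 := ih x
    push_cast
    linarith

/-- near-identity maps lift to near-identity maps -/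
theorem rz_near_lift {S M : Type*} [MetricSpace S] [MetricSpace M] {p : S → M} (hp : Continuous p)
    {δ : ℝ} (hδ : 0 < δ) (hP1 : ∀ z w, p z = p w → dist z w < δ → z = w)
    (hP2 : ∀ ε > 0, ∃ η > 0, ∀ z x, dist x (p z) < η → ∃ w, dist w z < ε ∧ p w = x)
    {ε : ℝ} (hε : 0 < ε) (hεδ : ε ≤ δ / 8) :
    ∃ η > 0, ∀ h : M → M, Continuous h → (∀ x, dist (h x) x < η) →
      ∃ Φ : S → S, Continuous Φ ∧ (∀ z, p (Φ z) = h (p z)) ∧ ∀ z, dist (Φ z) z < ε := by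
  obtain ⟨η, hη, hP⟩ := hP2 ε hε
  refine ⟨η, hη, fun h hh hd => ?_⟩
  choose Φ hΦ1 hΦ2 using fun z => hP z (h (p z)) (hd _)
  refine ⟨Φ, ?_, hΦ2, hΦ1⟩
  rw [continuous_iff_continuousAt]
  intro z
  rw [Metric.continuousAt_iff]
  intro ε' hε'
  obtain ⟨η', hη', hP'⟩ := hP2 (min ε' (δ / 4)) (by positivity)
  obtain ⟨r, hr, hrr⟩ := Metric.continuousAt_iff.1 ((hh.comp hp).continuousAt (x := z)) η' hη'
  refine ⟨min r (δ / 4), by positivity, fun {z'} hz' => ?_⟩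
  have h1 := hrr (lt_of_lt_of_le hz' (min_le_left _ _))
  simp only [Function.comp] at h1
  rw [← hΦ2 z] at h1
  obtain ⟨w, hw1, hw2⟩ := hP' (Φ z) _ h1
  have hwe : w = Φ z' := by
    apply hP1
    · rw [hw2, hΦ2]
    · have e1 := dist_triangle w (Φ z) (Φ z')
      have e2 := dist_triangle4 (Φ z) z z' (Φ z')
      have e3 := hΦ1 z
      have e4 := hΦ1 z'
      have e5 := lt_of_lt_of_le hz' (min_le_right _ _)
      have e6 := lt_of_lt_of_le hw1 (min_le_right _ _)
      rw [dist_comm z' (Φ z')] at e2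
      rw [dist_comm z' z] at e5
      linarith
  rw [← hwe]
  exact lt_of_lt_of_le hw1 (min_le_left _ _)

theorem rz_reduction {S M : Type*} [MetricSpace S] [PreconnectedSpace S] [MetricSpace M] {p : S → M}
    (hp : Continuous p) (hps : Function.Surjective p)
    {δ : ℝ} (hδ : 0 < δ) (hP1 : ∀ z w, p z = p w → dist z w < δ → z = w)
    (hP2 : ∀ ε > 0, ∃ η > 0, ∀ z x, dist x (p z) < η → ∃ w, dist w z < ε ∧ p w = x)
    {δ0 : ℝ} (hδ0 : 0 < δ0)
    (hS : ∀ F : S ≃ₜ S, (∀ z, dist (F z) z < δ0) →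
      (∀ ε > 0, ∀ m : ℕ, ∃ n ≥ m, ∀ z, dist (F^[n] z) z < ε) → ∀ z, F z = z)
    (f : M ≃ₜ M) (hrec : IsRecurrent (f : M → M))
    (hper : ∃ x₀, ∃ m ≥ 1, (f : M → M)^[m] x₀ = x₀) :
    ∃ n ≥ 1, ∀ x, (f : M → M)^[n] x = x := by
  obtain ⟨x₀, m, hm, hx₀⟩ := hper
  have hrec' : ∀ ε > 0, ∀ j : ℕ, ∃ n ≥ j, ∀ x, dist (f^[n] x) x < ε := by
    intro ε hε j
    obtain ⟨n, hn, h⟩ := hrec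
    obtain ⟨k, hk1, hk2⟩ := ((h ε hε).and (hn.eventually_ge_atTop j)).exists
    exact ⟨n k, hk2, hk1⟩
  have hpow : ∀ ε > 0, ∀ N j : ℕ, ∃ n ≥ j, ∀ x, dist (f^[n * N] x) x < ε := by
    intro ε hε N j
    obtain ⟨n, hn, h⟩ := hrec' (ε / (N + 1)) (by positivity) j
    refine ⟨n, hn, fun x => ?_⟩
    rw [Function.iterate_mul]
    refine lt_of_le_of_lt (rz_iter_dist h N x) ?_
    rw [mul_div_assoc', div_lt_iff₀ (by positivity)]
    nlinarith
  set ε0 := min (δ / 8) δ0 with hε0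
  have hε0p : 0 < ε0 := by positivity
  have hε0δ : ε0 ≤ δ / 8 := min_le_left _ _
  obtain ⟨η0, hη0, hlift⟩ := rz_near_lift hp hδ hP1 hP2 hε0p hε0δ
  obtain ⟨n0, hn0, hgd⟩ := hpow η0 hη0 m 1
  set N := n0 * m with hN
  have hN1 : 1 ≤ N := Nat.mul_pos hn0 hm
  obtain ⟨g, hg⟩ : ∃ g : M ≃ₜ M, ∀ x, g x = f^[N] x := by
    refine ⟨⟨⟨f^[N], f.symm^[N], ?_, ?_⟩, f.continuous.iterate N, f.symm.continuous.iterate N⟩, fun x => rfl⟩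
    · exact Function.LeftInverse.iterate f.symm_apply_apply N
    · exact Function.LeftInverse.iterate f.apply_symm_apply N
  have hgf : (g : M → M) = f^[N] := funext hg
  have hgx : g x₀ = x₀ := by
    rw [hg, hN, mul_comm, Function.iterate_mul]
    exact Function.iterate_fixed hx₀ n0
  have hgn : ∀ ε > 0, ∀ j : ℕ, ∃ n ≥ j, ∀ x, dist (g^[n] x) x < ε := by
    intro ε hε j
    obtain ⟨n, hn, h⟩ := hpow ε hε N j
    refine ⟨n, hn, fun x => ?_⟩
    rw [hgf, ← Function.iterate_mul, mul_comm]
    exact h x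
  obtain ⟨Φ, hΦ, hΦp, hΦd⟩ := hlift g g.continuous (fun x => by rw [hg]; exact hgd x)
  obtain ⟨Ψ, hΨ, hΨp, hΨd⟩ := hlift g.symm g.symm.continuous (fun x => by
    have := hgd (g.symm x)
    rw [← hg, g.apply_symm_apply, dist_comm] at this
    exact this)
  obtain ⟨F, hF⟩ : ∃ F : S ≃ₜ S, ∀ z, F z = Φ z := by
    refine ⟨⟨⟨Φ, Ψ, ?_, ?_⟩, hΦ, hΨ⟩, fun z => rfl⟩
    · intro z
      apply hP1
      · rw [hΨp, hΦp, g.symm_apply_apply]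
      · have := dist_triangle (Ψ (Φ z)) (Φ z) z
        linarith [hΨd (Φ z), hΦd z]
    · intro z
      apply hP1
      · rw [hΦp, hΨp, g.apply_symm_apply]
      · have := dist_triangle (Φ (Ψ z)) (Ψ z) z
        linarith [hΦd (Ψ z), hΨd z]
  have hFp : ∀ z, p (F z) = g (p z) := fun z => by rw [hF, hΦp]
  have hFd : ∀ z, dist (F z) z < ε0 := fun z => by rw [hF]; exact hΦd z
  have hFpn : ∀ (n : ℕ) z, p (F^[n] z) = g^[n] (p z) := by
    intro n
    induction n with
    | zero => intro z; rfl
    | succ n ih => intro z; rw [Function.iterate_succ_apply', Function.iterate_succ_apply', hFp, ih]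
  obtain ⟨z₀, hz₀⟩ := hps x₀
  have hFz : F z₀ = z₀ := by
    apply hP1
    · rw [hFp, hz₀, hgx]
    · linarith [hFd z₀]
  have hFrec : ∀ ε > 0, ∀ m : ℕ, ∃ n ≥ m, ∀ z, dist (F^[n] z) z < ε := by
    intro ε hε j
    obtain ⟨η, hη, hl⟩ := rz_near_lift hp hδ hP1 hP2 (ε := min ε ε0) (by positivity) ((min_le_right _ _).trans hε0δ)
    obtain ⟨n, hn, hd⟩ := hgn η hη j
    refine ⟨n, hn, ?_⟩
    obtain ⟨Θ, hΘ, hΘp, hΘd⟩ := hl (g^[n]) (g.continuous.iterate n) hd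
    have hΘz : Θ z₀ = z₀ := by
      apply hP1
      · rw [hΘp, hz₀]; exact Function.iterate_fixed hgx n
      · have := lt_of_lt_of_le (hΘd z₀) (min_le_right _ _)
        linarith
    have hFc : Continuous (F^[n]) := F.continuous.iterate n
    have hset : {z | F^[n] z = Θ z} = {z | dist (F^[n] z) (Θ z) < δ} := by
      ext z
      constructor
      · intro h
        change dist (F^[n] z) (Θ z) < δ
        rw [show F^[n] z = Θ z from h, dist_self]; exact hδ
      · intro h
        exact hP1 _ _ (by rw [hFpn, hΘp]) h
    have hclo : IsClopen {z | F^[n] z = Θ z} := by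
      refine ⟨isClosed_eq hFc hΘ, ?_⟩
      rw [hset]
      exact isOpen_lt (hFc.dist hΘ) continuous_const
    have huniv := hclo.eq_univ ⟨z₀, show F^[n] z₀ = Θ z₀ by rw [hΘz]; exact Function.iterate_fixed hFz n⟩
    intro z
    have hz : z ∈ {z | F^[n] z = Θ z} := huniv ▸ Set.mem_univ z
    rw [show F^[n] z = Θ z from hz]
    exact lt_of_lt_of_le (hΘd z) (min_le_left _ _)
  have hid := hS F (fun z => lt_of_lt_of_le (hFd z) (min_le_right _ _)) hFrec
  refine ⟨N, hN1, fun x => ?_⟩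
  obtain ⟨z, rfl⟩ := hps x
  rw [← hg, ← hFp, hid]

/-- quotients by isometries acting cocompactly and uniformly discretely -/
theorem rz_quotient {S Q M : Type*} [MetricSpace S] [PreconnectedSpace S] [TopologicalSpace Q]
    [MetricSpace M] (e : M ≃ₜ Q) {p₀ : S → Q}
    (hp₀ : IsQuotientMap p₀) (Γ : Set (S ≃ᵢ S))
    (hΓ : ∀ z w, p₀ z = p₀ w ↔ ∃ γ ∈ Γ, γ z = w)
    {K : Set S} (hK : IsCompact K) (hKΓ : ∀ z, ∃ γ ∈ Γ, γ z ∈ K)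
    {δ : ℝ} (hδ : 0 < δ) (hP1 : ∀ γ ∈ Γ, ∀ z, dist (γ z) z < δ → γ z = z)
    {δ0 : ℝ} (hδ0 : 0 < δ0)
    (hS : ∀ F : S ≃ₜ S, (∀ z, dist (F z) z < δ0) →
      (∀ ε > 0, ∀ m : ℕ, ∃ n ≥ m, ∀ z, dist (F^[n] z) z < ε) → ∀ z, F z = z)
    (f : M ≃ₜ M) (hrec : IsRecurrent (f : M → M))
    (hper : ∃ x₀, ∃ m ≥ 1, (f : M → M)^[m] x₀ = x₀) :
    ∃ n ≥ 1, ∀ x, (f : M → M)^[n] x = x := by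
  have hopen : IsOpenMap p₀ := by
    intro U hU
    rw [← hp₀.isOpen_preimage]
    have : p₀ ⁻¹' (p₀ '' U) = ⋃ γ ∈ Γ, γ ⁻¹' U := by
      ext z
      simp only [Set.mem_preimage, Set.mem_image, Set.mem_iUnion, exists_prop]
      constructor
      · rintro ⟨u, hu, h⟩
        obtain ⟨γ, h1, h2⟩ := (hΓ z u).1 h.symm
        exact ⟨γ, h1, h2 ▸ hu⟩
      · rintro ⟨γ, h1, h2⟩
        exact ⟨γ z, h2, ((hΓ z _).2 ⟨γ, h1, rfl⟩).symm⟩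
    rw [this]
    exact isOpen_biUnion fun γ _ => hU.preimage γ.continuous
  set p : S → M := e.symm ∘ p₀ with hp
  have hpc : Continuous p := e.symm.continuous.comp hp₀.continuous
  have hpo : IsOpenMap p := e.symm.isOpenMap.comp hopen
  have hpe : ∀ z w, p z = p w ↔ ∃ γ ∈ Γ, γ z = w := by
    intro z w
    rw [← hΓ]
    exact e.symm.injective.eq_iff
  refine rz_reduction (p := p) hpc (e.symm.surjective.comp hp₀.surjective) hδ ?_ ?_ hδ0 hS f hrec hper
  · intro z w h hd
    obtain ⟨γ, h1, rfl⟩ := (hpe z w).1 h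
    rw [dist_comm] at hd
    exact (hP1 γ h1 z hd).symm
  · intro ε hε
    have hKe : ∃ η > 0, ∀ z ∈ K, ∀ x, dist x (p z) < η → ∃ w, dist w z < ε ∧ p w = x := by
      refine hK.induction_on (p := fun s => ∃ η > 0, ∀ z ∈ s, ∀ x, dist x (p z) < η → ∃ w, dist w z < ε ∧ p w = x)
        ⟨1, one_pos, by simp⟩ ?_ ?_ ?_
      · rintro s t hst ⟨η, h1, h2⟩
        exact ⟨η, h1, fun z hz => h2 z (hst hz)⟩
      · rintro s t ⟨η, h1, h2⟩ ⟨η', h1', h2'⟩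
        refine ⟨min η η', by positivity, ?_⟩
        rintro z (hz | hz) x hx
        · exact h2 z hz x (lt_of_lt_of_le hx (min_le_left _ _))
        · exact h2' z hz x (lt_of_lt_of_le hx (min_le_right _ _))
      · intro z _
        have h1 : p '' ball z (ε / 2) ∈ 𝓝 (p z) := hpo.image_mem_nhds (ball_mem_nhds z (by positivity))
        obtain ⟨η, hη, hb⟩ := Metric.mem_nhds_iff.1 h1
        have h2 : ball z (ε / 2) ∩ p ⁻¹' ball (p z) (η / 2) ∈ 𝓝 z :=
          inter_mem (ball_mem_nhds z (by positivity)) (hpc.continuousAt (ball_mem_nhds _ (by positivity)))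
        refine ⟨_, mem_nhdsWithin_of_mem_nhds h2, η / 2, by positivity, ?_⟩
        rintro z' ⟨hz1, hz2⟩ x hx
        have hz2' : dist (p z') (p z) < η / 2 := hz2
        have hz1' : dist z' z < ε / 2 := hz1
        obtain ⟨w, hw, rfl⟩ := hb (show dist x (p z) < η by linarith [dist_triangle x (p z') (p z)])
        have hw' : dist w z < ε / 2 := hw
        exact ⟨w, by linarith [dist_triangle_right w z' z], rfl⟩
    obtain ⟨η, hη, hKη⟩ := hKe
    refine ⟨η, hη, fun z x hx => ?_⟩
    obtain ⟨γ, h1, h2⟩ := hKΓ z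
    have h3 : p z = p (γ z) := (hpe _ _).2 ⟨γ, h1, rfl⟩
    rw [h3] at hx
    obtain ⟨w, hw1, hw2⟩ := hKη _ h2 x hx
    refine ⟨γ.symm w, ?_, ?_⟩
    · rw [← γ.dist_eq, γ.apply_symm_apply]; exact hw1
    · rw [← hw2]
      exact (hpe _ _).2 ⟨γ, h1, γ.apply_symm_apply w⟩


theorem rz_planeR (F : ℝ × ℝ ≃ₜ ℝ × ℝ) (hd : ∀ z, dist (F z) z < 1)
    (hr : ∀ ε > 0, ∀ m : ℕ, ∃ n ≥ m, ∀ z, dist (F^[n] z) z < ε) : ∀ z, F z = z := by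
  let e : ℂ ≃ₜ ℝ × ℝ := Complex.equivRealProdCLM.toHomeomorph
  have he1 : ∀ w : ℂ, (e w).1 = w.re := fun w => rfl
  have he2 : ∀ w : ℂ, (e w).2 = w.im := fun w => rfl
  have hnorm : ∀ u v : ℂ, ‖u - v‖ ≤ 2 * dist (e u) (e v) := by
    intro u v
    have h1 := Complex.norm_le_abs_re_add_abs_im (u - v)
    have h2 : |u.re - v.re| ≤ dist (e u) (e v) := by
      rw [Prod.dist_eq, ← Real.dist_eq]; exact le_max_left _ _
    have h3 : |u.im - v.im| ≤ dist (e u) (e v) := by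
      rw [Prod.dist_eq, ← Real.dist_eq]; exact le_max_right _ _
    simp only [Complex.sub_re, Complex.sub_im] at h1
    linarith
  obtain ⟨G, hG⟩ : ∃ G : ℂ ≃ₜ ℂ, ∀ w, e (G w) = F (e w) := ⟨e.trans (F.trans e.symm), fun w => by simp⟩
  have hit : ∀ (n : ℕ) w, e (G^[n] w) = F^[n] (e w) := by
    intro n
    induction n with
    | zero => intro w; rfl
    | succ n ih => intro w; rw [Function.iterate_succ_apply', Function.iterate_succ_apply', hG, ih]
  have h := rz_plane G (C := 2) (by
    intro z
    have h1 := hnorm (G z) z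
    rw [hG] at h1
    linarith [hd (e z)]) (by
    intro ε hε m
    obtain ⟨n, hn, h⟩ := hr (ε / 2) (by positivity) m
    refine ⟨n, hn, fun z => ?_⟩
    have h1 := hnorm (G^[n] z) z
    rw [hit] at h1
    linarith [h (e z)])
  intro z
  have := hG (e.symm z)
  rw [h, e.apply_symm_apply] at this
  exact this.symm

/-- invariance of the boundary of a strip -/
theorem rz_strip_bdry {a b : ℝ} (F : ℝ × Set.Icc a b ≃ₜ ℝ × Set.Icc a b) (z : ℝ × Set.Icc a b)
    (hz : (z.2 : ℝ) = a ∨ (z.2 : ℝ) = b) : ((F z).2 : ℝ) = a ∨ ((F z).2 : ℝ) = b := by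
  classical
  by_contra! hc
  set c := F z with hcd
  have hca : a < c.2 := lt_of_le_of_ne c.2.2.1 (Ne.symm hc.1)
  have hcb : c.2 < b := lt_of_le_of_ne c.2.2.2 hc.2
  have hab : a ≤ b := (hca.trans hcb).le
  set ρ := min ((c.2:ℝ) - a) (b - c.2) with hρ
  have hρ0 : 0 < ρ := lt_min (by linarith) (by linarith)
  have hρa : ρ ≤ c.2 - a := min_le_left _ _
  have hρb : ρ ≤ b - c.2 := min_le_right _ _
  have him : ∀ w : sphere (0:ℂ) ρ, (c.2 : ℝ) + (w:ℂ).im ∈ Set.Icc a b := by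
    intro w
    have h1 := Complex.abs_im_le_norm (w:ℂ)
    have h2 : ‖(w:ℂ)‖ = ρ := by simpa using w.2
    rw [h2, abs_le] at h1
    constructor <;> linarith [h1.1, h1.2]
  let θ : sphere (0:ℂ) ρ → ℝ × Set.Icc a b := fun w => F.symm (c.1 + (w:ℂ).re, ⟨c.2 + (w:ℂ).im, him w⟩)
  have hθc : Continuous θ := by
    apply F.symm.continuous.comp
    fun_prop
  have hθz : ∀ w, θ w ≠ z := by
    intro w h
    have h1 : (c.1 + (w:ℂ).re, (⟨c.2 + (w:ℂ).im, him w⟩ : Set.Icc a b)) = c := by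
      exact (F.apply_symm_apply _).symm.trans (congrArg F h)
    have h2 := congrArg Prod.fst h1
    have h3 := congrArg (fun q => (q.2 : ℝ)) h1
    simp only at h2 h3
    have h4 : (w:ℂ) = 0 := Complex.ext (by simpa using h2) (by simpa using h3)
    have h5 : ‖(w:ℂ)‖ = ρ := by simpa using w.2
    rw [h4, norm_zero] at h5
    linarith
  have hconv : ∀ (s : unitInterval) (y : Set.Icc a b), (s:ℝ) * y + (1 - s) * c.2 ∈ Set.Icc a b := by
    intro s y
    exact (convex_Icc a b) y.2 c.2.2 s.2.1 (by linarith [s.2.2]) (by ring)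
  let h : unitInterval × sphere (0:ℂ) ρ → ℝ × Set.Icc a b := fun q =>
    (q.1 * (θ q.2).1 + (1 - q.1) * c.1, ⟨_, hconv q.1 (θ q.2).2⟩)
  have hh : Continuous h := by fun_prop
  have hhz : ∀ q, h q ≠ z := by
    rintro ⟨s, w⟩ hq
    have h3 : (s:ℝ) * (θ w).2 + (1 - s) * c.2 = z.2 := congrArg (fun q => (q.2 : ℝ)) hq
    have hs0 := s.2.1
    have hs1 := s.2.2
    have hy1 := (θ w).2.2.1
    have hy2 := (θ w).2.2.2
    have hs : (s:ℝ) = 1 := by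
      by_contra hne
      have hlt : (s:ℝ) < 1 := lt_of_le_of_ne hs1 hne
      rcases hz with hz | hz
      · rw [hz] at h3; nlinarith
      · rw [hz] at h3; nlinarith
    apply hθz w
    have h4 : (s:ℝ) * (θ w).1 + (1 - s) * c.1 = z.1 := congrArg Prod.fst hq
    rw [hs] at h3 h4
    apply Prod.ext
    · linarith
    · apply Subtype.ext; linarith
  let ι : ℝ × Set.Icc a b → ℂ := fun q => ⟨q.1, q.2⟩
  have hι : Continuous ι := by
    have : ι = fun q => (q.1 : ℂ) + (q.2 : ℝ) * Complex.I := by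
      ext q
      apply Complex.ext <;> simp [ι]
    rw [this]
    fun_prop
  have hιi : ∀ u v, ι u - ι v = 0 → u = v := by
    intro u v huv
    have h0 := sub_eq_zero.1 huv
    exact Prod.ext (congrArg Complex.re h0) (Subtype.ext (congrArg Complex.im h0))
  have hne : ∀ q, ι (F (h q)) - ι c ≠ 0 := by
    intro q h0
    exact hhz q (F.injective (hιi _ _ h0))
  let Hm : C(unitInterval × sphere (0:ℂ) ρ, {z : ℂ // z ≠ 0}) :=
    ⟨fun q => ⟨ι (F (h q)) - ι c, hne q⟩, by
      apply Continuous.subtype_mk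
      exact (hι.comp (F.continuous.comp hh)).sub continuous_const⟩
  have hh0 : ∀ w, h (0, w) = c := by
    intro w
    apply Prod.ext
    · simp [h]
    · apply Subtype.ext; simp [h]
  have hFc : ι (F c) - ι c ≠ 0 := by
    intro h0
    have h1 := hιi _ _ h0
    have h2 : F c = F z := by rw [h1]
    have h3 := F.injective h2
    rw [h3] at hca hcb
    rcases hz with hz | hz <;> linarith
  obtain ⟨l0, hl0⟩ : ∃ l0, Complex.exp l0 = ι (F c) - ι c := ⟨_, Complex.exp_log hFc⟩
  have hH0 : ∀ w, Hm (0, w) = (⟨_, Complex.exp_ne_zero ((ContinuousMap.const _ l0 : C(sphere (0:ℂ) ρ, ℂ)) w)⟩ : {z : ℂ // z ≠ 0}) := by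
    intro w
    apply Subtype.ext
    simp only [Hm, ContinuousMap.coe_mk, ContinuousMap.const_apply]
    rw [hh0, hl0]
  obtain ⟨g, hge⟩ : ∃ g : C(unitInterval × sphere (0:ℂ) ρ, ℂ), ∀ q, Complex.exp (g q) = ι (F (h q)) - ι c := by
    refine ⟨Complex.isCoveringMap_exp.liftHomotopy Hm _ hH0, fun q => ?_⟩
    have := congrFun (Complex.isCoveringMap_exp.liftHomotopy_lifts Hm _ hH0) q
    exact congrArg Subtype.val this
  have hdef : ∀ w : sphere (0:ℂ) ρ, (fun z : ℂ => if h : z ∈ sphere (0:ℂ) ρ then g (1, ⟨z, h⟩) else 0) w = g (1, w) := by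
    intro w
    have : (w:ℂ) ∈ sphere (0:ℂ) ρ := w.2
    simp only [this, dif_pos]
  apply rz_no_log_circle hρ0 (fun z : ℂ => if h : z ∈ sphere (0:ℂ) ρ then g (1, ⟨z, h⟩) else 0)
  · rw [continuousOn_iff_continuous_domRestrict]
    have e : (sphere (0:ℂ) ρ).domRestrict (fun z : ℂ => if h : z ∈ sphere (0:ℂ) ρ then g (1, ⟨z, h⟩) else 0)
        = fun w => g (1, w) := by
      ext w
      exact hdef w
    rw [e]
    fun_prop
  · intro w hw
    refine (congrArg Complex.exp (hdef ⟨w, hw⟩)).trans ?_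
    rw [hge]
    have e1 : h (1, ⟨w, hw⟩) = θ ⟨w, hw⟩ := by
      apply Prod.ext
      · simp [h]
      · apply Subtype.ext; simp [h]
    rw [e1]
    simp only [θ, F.apply_symm_apply]
    apply Complex.ext <;> simp [ι]

theorem rz_line {φ : ℝ → ℝ} (hφ : Continuous φ) (hi : Function.Injective φ) {C : ℝ} (hb : ∀ x, |φ x - x| ≤ C)
    (hr : ∀ ε > 0, ∃ n ≥ 1, ∀ x, |φ^[n] x - x| < ε) : ∀ x, φ x = x := by
  have hmono : StrictMono φ := by
    rcases hφ.strictMono_of_inj hi with h | h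
    · exact h
    · exfalso
      have hC : 0 ≤ C := (abs_nonneg _).trans (hb 0)
      have h1 := h (show (0:ℝ) < 2 * C + 1 by linarith)
      have h2 := abs_le.1 (hb 0)
      have h3 := abs_le.1 (hb (2 * C + 1))
      linarith [h2.1, h2.2, h3.1, h3.2]
  intro x
  by_contra hne
  obtain ⟨n, hn, h⟩ := hr |φ x - x| (abs_pos.2 (sub_ne_zero.2 hne))
  have hx := h x
  have hgt : x < φ x → φ x ≤ φ^[n] x := by
    intro hlt
    clear h hx
    induction n, hn using Nat.le_induction with
    | base => simp
    | succ n hn ih =>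
      rw [Function.iterate_succ_apply']
      exact hmono.monotone (by linarith)
  have hlt : φ x < x → φ^[n] x ≤ φ x := by
    intro hlt
    clear h hx hgt
    induction n, hn using Nat.le_induction with
    | base => simp
    | succ n hn ih =>
      rw [Function.iterate_succ_apply']
      exact hmono.monotone (by linarith)
  rcases lt_or_gt_of_ne hne with h1 | h1
  · have := hlt h1
    rw [abs_of_neg (by linarith), abs_of_neg (by linarith)] at hx
    linarith
  · have := hgt h1
    rw [abs_of_pos (by linarith), abs_of_pos (by linarith)] at hx
    linarith

theorem rz_strip_fix {a b : ℝ} (F : ℝ × Set.Icc a b ≃ₜ ℝ × Set.Icc a b)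
    (hd : ∀ z, dist (F z) z < b - a)
    (hr : ∀ ε > 0, ∀ m : ℕ, ∃ n ≥ m, ∀ z, dist (F^[n] z) z < ε) (z : ℝ × Set.Icc a b)
    (hz : (z.2 : ℝ) = a ∨ (z.2 : ℝ) = b) : F z = z := by
  have hpres : ∀ w : ℝ × Set.Icc a b, w.2 = z.2 → (F w).2 = z.2 := by
    intro w hw
    have h1 : ((w.2 : ℝ) = a ∨ (w.2 : ℝ) = b) := by rw [hw]; exact hz
    have h2 := rz_strip_bdry F w h1
    have h3 : |((F w).2 : ℝ) - w.2| < b - a := by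
      refine lt_of_le_of_lt ?_ (hd w)
      rw [Prod.dist_eq, ← Real.dist_eq, ← Subtype.dist_eq]; exact le_max_right _ _
    rw [abs_lt] at h3
    rw [← hw]
    apply Subtype.ext
    rcases h1 with h1 | h1 <;> rcases h2 with h2 | h2 <;> first | (rw [h1, h2]; done) | (exfalso; rw [h1, h2] at h3; linarith [h3.1, h3.2])
  have hd1 : ∀ u v : ℝ × Set.Icc a b, |u.1 - v.1| ≤ dist u v := by
    intro u v
    rw [Prod.dist_eq, ← Real.dist_eq]; exact le_max_left _ _
  set φ : ℝ → ℝ := fun x => (F (x, z.2)).1 with hφd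
  have hF : ∀ x, F (x, z.2) = (φ x, z.2) := fun x => Prod.ext rfl (hpres _ rfl)
  have hFn : ∀ (n : ℕ) x, F^[n] (x, z.2) = (φ^[n] x, z.2) := by
    intro n
    induction n with
    | zero => intro x; rfl
    | succ n ih => intro x; rw [Function.iterate_succ_apply', Function.iterate_succ_apply', ih, hF]
  have hid := rz_line (φ := φ) (C := b - a) (by
      have := F.continuous
      fun_prop) (by
      intro x y hxy
      have h1 : F (x, z.2) = F (y, z.2) := by rw [hF, hF, hxy]
      exact congrArg Prod.fst (F.injective h1)) (by
      intro x
      exact (hd1 (F (x, z.2)) (x, z.2)).trans (hd _).le) (by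
      intro ε hε
      obtain ⟨n, hn, h⟩ := hr ε hε 1
      refine ⟨n, hn, fun x => ?_⟩
      have h1 := hd1 (F^[n] (x, z.2)) (x, z.2)
      rw [hFn] at h1
      have h2 := h (x, z.2)
      rw [hFn] at h2
      exact lt_of_le_of_lt h1 h2)
  have := hF z.1
  rw [hid] at this
  exact this

theorem rz_strip {a b : ℝ} (hab : a ≤ b) (F : ℝ × Set.Icc a b ≃ₜ ℝ × Set.Icc a b)
    (hd : ∀ z, dist (F z) z < b - a)
    (hr : ∀ ε > 0, ∀ m : ℕ, ∃ n ≥ m, ∀ z, dist (F^[n] z) z < ε) : ∀ z, F z = z := by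
  have hfix := rz_strip_fix F hd hr
  have hfix' : ∀ z : ℝ × Set.Icc a b, ((z.2 : ℝ) = a ∨ (z.2 : ℝ) = b) → F.symm z = z := by
    intro z hz
    rw [F.symm_apply_eq]
    exact (hfix z hz).symm
  let ι : ℝ × Set.Icc a b → ℂ := fun q => ⟨q.1, q.2⟩
  have hι : Continuous ι := by
    have : ι = fun q => (q.1 : ℂ) + (q.2 : ℝ) * Complex.I := by
      ext q
      apply Complex.ext <;> simp [ι]
    rw [this]
    fun_prop
  let π : ℂ → ℝ × Set.Icc a b := fun w => (w.re, Set.projIcc a b hab w.im)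
  have hπ : Continuous π := by
    have := continuous_projIcc (h := hab)
    have h1 := Complex.continuous_re
    have h2 := Complex.continuous_im
    fun_prop
  have hπι : ∀ s, π (ι s) = s := by
    intro s
    apply Prod.ext
    · rfl
    · exact Set.projIcc_val hab s.2
  have hιπ : ∀ w : ℂ, w.im ∈ Set.Icc a b → ι (π w) = w := by
    intro w hw
    apply Complex.ext
    · rfl
    · simp only [ι, π]
      rw [Set.projIcc_of_mem hab hw]
  have hout : ∀ w : ℂ, w.im ∉ Set.Icc a b → (((π w).2 : ℝ) = a ∨ ((π w).2 : ℝ) = b) := by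
    intro w hw
    simp only [π]
    rw [Set.mem_Icc, not_and_or, not_le, not_le] at hw
    rcases hw with h | h
    · left; rw [Set.projIcc_of_le_left hab h.le]
    · right; rw [Set.projIcc_of_right_le hab h.le]
  let ext : (ℝ × Set.Icc a b → ℝ × Set.Icc a b) → ℂ → ℂ := fun f w => w + (ι (f (π w)) - ι (π w))
  have hext_c : ∀ f, Continuous f → Continuous (ext f) := by
    intro f hf
    exact continuous_id.add ((hι.comp (hf.comp hπ)).sub (hι.comp hπ))
  have hext_in : ∀ f s, ext f (ι s) = ι (f s) := by
    intro f s
    simp only [ext, hπι]; ring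
  have hext_out : ∀ f w, f (π w) = π w → ext f w = w := by
    intro f w h
    simp only [ext, h]; ring
  have hnorm : ∀ s t, ‖ι s - ι t‖ ≤ 2 * dist s t := by
    intro s t
    have h1 := Complex.norm_le_abs_re_add_abs_im (ι s - ι t)
    have h2 : |s.1 - t.1| ≤ dist s t := by
      rw [Prod.dist_eq, ← Real.dist_eq]; exact le_max_left _ _
    have h3 : |(s.2:ℝ) - t.2| ≤ dist s t := by
      rw [Prod.dist_eq, ← Real.dist_eq, ← Subtype.dist_eq]; exact le_max_right _ _
    simp only [Complex.sub_re, Complex.sub_im] at h1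
    have h4 : |(ι s).re - (ι t).re| + |(ι s).im - (ι t).im| = |s.1 - t.1| + |(s.2:ℝ) - t.2| := rfl
    linarith
  have hinv : ∀ f g : ℝ × Set.Icc a b → ℝ × Set.Icc a b, (∀ s, f (g s) = s) →
      (∀ z : ℝ × Set.Icc a b, ((z.2 : ℝ) = a ∨ (z.2 : ℝ) = b) → f z = z) →
      (∀ z : ℝ × Set.Icc a b, ((z.2 : ℝ) = a ∨ (z.2 : ℝ) = b) → g z = z) → ∀ w, ext f (ext g w) = w := by
    intro f g hfg hf hg w
    by_cases hw : w.im ∈ Set.Icc a b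
    · rw [← hιπ w hw, hext_in, hext_in, hfg]
    · rw [hext_out g w (hg _ (hout w hw)), hext_out f w (hf _ (hout w hw))]
  obtain ⟨G, hG⟩ : ∃ G : ℂ ≃ₜ ℂ, ∀ w, G w = ext F w :=
    ⟨⟨⟨ext F, ext F.symm, hinv _ _ F.symm_apply_apply hfix' hfix, hinv _ _ F.apply_symm_apply hfix hfix'⟩,
      hext_c _ F.continuous, hext_c _ F.symm.continuous⟩, fun w => rfl⟩
  have hGn : ∀ (n : ℕ) s, G^[n] (ι s) = ι (F^[n] s) := by
    intro n
    induction n with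
    | zero => intro s; rfl
    | succ n ih => intro s; rw [Function.iterate_succ_apply', Function.iterate_succ_apply', ih, hG, hext_in]
  have hGout : ∀ w : ℂ, w.im ∉ Set.Icc a b → G w = w := fun w hw => by
    rw [hG, hext_out F w (hfix _ (hout w hw))]
  have hid := rz_plane G (C := 2 * (b - a)) (by
    intro w
    have h1 := hnorm (F (π w)) (π w)
    have h2 := hd (π w)
    rw [hG]
    simp only [ext, add_sub_cancel_left]
    linarith) (by
    intro ε hε m
    obtain ⟨n, hn, h⟩ := hr (ε / 2) (by positivity) m
    refine ⟨n, hn, fun w => ?_⟩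
    by_cases hw : w.im ∈ Set.Icc a b
    · rw [← hιπ w hw, hGn]
      have h1 := hnorm (F^[n] (π w)) (π w)
      have h2 := h (π w)
      linarith
    · rw [Function.iterate_fixed (hGout w hw), sub_self, norm_zero]; exact hε)
  intro z
  have h1 := hid (ι z)
  rw [hG, hext_in] at h1
  rw [← hπι (F z), h1, hπι]


theorem rz_iso_add {A B : Type*} [PseudoMetricSpace A] [PseudoMetricSpace B] (g : A ≃ᵢ A) (h : B ≃ᵢ B) :
    ∃ γ : A × B ≃ᵢ A × B, ∀ z, γ z = (g z.1, h z.2) := by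
  refine ⟨⟨g.toEquiv.prodCongr h.toEquiv, g.isometry.prodMap h.isometry⟩, fun z => rfl⟩

theorem rz_iso_sign (s : ℤˣ) (m : ℤ) : ∃ g : ℝ ≃ᵢ ℝ, ∀ x, g x = ((s : ℤ) : ℝ) * x + m := by
  rcases Int.units_eq_one_or s with rfl | rfl
  · exact ⟨IsometryEquiv.addRight (m : ℝ), fun x => by simp⟩
  · exact ⟨(IsometryEquiv.neg ℝ).trans (IsometryEquiv.addRight (m : ℝ)), fun x => by simp⟩

theorem rz_int_small {k : ℤ} (h : |(k : ℝ)| < 1 / 2) : k = 0 := by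
  have h2 : |(k : ℝ)| < 1 := by linarith
  have : |k| < 1 := by exact_mod_cast h2
  exact Int.abs_lt_one_iff.1 this

theorem rz_fract_mem (x : ℝ) : x + ((-⌊x⌋ : ℤ) : ℝ) ∈ Set.Icc (0:ℝ) 1 := by
  push_cast
  constructor
  · linarith [Int.floor_le x]
  · linarith [Int.lt_floor_add_one x]

theorem rz_circle_eq (x y : ℝ) : ((x : AddCircle (1:ℝ)) = y) ↔ ∃ m : ℤ, x + m = y := by
  rw [eq_comm, QuotientAddGroup.eq_iff_sub_mem, AddSubgroup.mem_zmultiples_iff]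
  constructor
  · rintro ⟨m, hm⟩
    exact ⟨m, by rw [zsmul_one] at hm; linarith⟩
  · rintro ⟨m, hm⟩
    exact ⟨m, by rw [zsmul_one]; linarith⟩

theorem rz_torus {M : Type*} [MetricSpace M] (e : M ≃ₜ Torus2) (f : M ≃ₜ M)
    (hrec : IsRecurrent (f : M → M)) (hper : ∃ x₀, ∃ m ≥ 1, (f : M → M)^[m] x₀ = x₀) :
    ∃ n ≥ 1, ∀ x, (f : M → M)^[n] x = x := by
  have hq : IsQuotientMap (fun z : ℝ × ℝ => ((z.1 : AddCircle (1:ℝ)), (z.2 : AddCircle (1:ℝ)))) := by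
    refine IsOpenMap.isQuotientMap ?_ ?_ ?_
    · exact (QuotientAddGroup.isOpenMap_coe).prodMap (QuotientAddGroup.isOpenMap_coe)
    · exact (AddCircle.continuous_mk' 1).prodMap (AddCircle.continuous_mk' 1)
    · exact Function.Surjective.prodMap QuotientAddGroup.mk_surjective QuotientAddGroup.mk_surjective
  have hex : ∀ m n : ℤ, ∃ γ : ℝ × ℝ ≃ᵢ ℝ × ℝ, ∀ z, γ z = (z.1 + m, z.2 + n) := fun m n => by
    obtain ⟨γ, h⟩ := rz_iso_add (IsometryEquiv.addRight (m : ℝ)) (IsometryEquiv.addRight (n : ℝ))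
    exact ⟨γ, h⟩
  refine rz_quotient e hq {γ | ∃ m n : ℤ, ∀ z, γ z = (z.1 + m, z.2 + n)} ?_
    (K := Set.Icc 0 1 ×ˢ Set.Icc 0 1) (isCompact_Icc.prod isCompact_Icc) ?_ (δ := 1/2) (by norm_num) ?_
    (δ0 := 1) one_pos (fun F => rz_planeR F) f hrec hper
  · intro z w
    simp only [Prod.mk.injEq, rz_circle_eq]
    constructor
    · rintro ⟨⟨m, hm⟩, ⟨n, hn⟩⟩
      obtain ⟨γ, h⟩ := hex m n
      exact ⟨γ, ⟨m, n, h⟩, (h z).trans (Prod.ext hm hn)⟩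
    · rintro ⟨γ, ⟨m, n, h⟩, rfl⟩
      rw [h]
      exact ⟨⟨m, rfl⟩, ⟨n, rfl⟩⟩
  · intro z
    obtain ⟨γ, h⟩ := hex (-⌊z.1⌋) (-⌊z.2⌋)
    refine ⟨γ, ⟨_, _, h⟩, ?_⟩
    rw [h]
    exact ⟨rz_fract_mem _, rz_fract_mem _⟩
  · rintro γ ⟨m, n, h⟩ z hd
    rw [h, Prod.dist_eq, max_lt_iff] at hd
    simp only [Real.dist_eq, add_sub_cancel_left] at hd
    rw [h, rz_int_small hd.1, rz_int_small hd.2]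
    simp

theorem rz_annulus {M : Type*} [MetricSpace M] (e : M ≃ₜ Annulus2) (f : M ≃ₜ M)
    (hrec : IsRecurrent (f : M → M)) (hper : ∃ x₀, ∃ m ≥ 1, (f : M → M)^[m] x₀ = x₀) :
    ∃ n ≥ 1, ∀ x, (f : M → M)^[n] x = x := by
  have hq : IsQuotientMap (fun z : ℝ × Set.Icc (0:ℝ) 1 => ((z.1 : AddCircle (1:ℝ)), z.2)) := by
    refine IsOpenMap.isQuotientMap ?_ ?_ ?_
    · exact (QuotientAddGroup.isOpenMap_coe).prodMap IsOpenMap.id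
    · exact (AddCircle.continuous_mk' 1).prodMap continuous_id
    · exact Function.Surjective.prodMap QuotientAddGroup.mk_surjective Function.surjective_id
  have hex : ∀ m : ℤ, ∃ γ : ℝ × Set.Icc (0:ℝ) 1 ≃ᵢ ℝ × Set.Icc (0:ℝ) 1, ∀ z, γ z = (z.1 + m, z.2) :=
    fun m => by
    obtain ⟨γ, h⟩ := rz_iso_add (IsometryEquiv.addRight (m : ℝ)) (IsometryEquiv.refl (Set.Icc (0:ℝ) 1))
    exact ⟨γ, h⟩
  refine rz_quotient e hq {γ | ∃ m : ℤ, ∀ z, γ z = (z.1 + m, z.2)} ?_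
    (K := Set.Icc 0 1 ×ˢ Set.univ) (isCompact_Icc.prod isCompact_univ) ?_ (δ := 1/2) (by norm_num) ?_
    (δ0 := 1 - 0) (by norm_num) (fun F => rz_strip zero_le_one F) f hrec hper
  · intro z w
    simp only [Prod.mk.injEq, rz_circle_eq]
    constructor
    · rintro ⟨⟨m, hm⟩, hn⟩
      obtain ⟨γ, h⟩ := hex m
      exact ⟨γ, ⟨m, h⟩, (h z).trans (Prod.ext hm hn)⟩
    · rintro ⟨γ, ⟨m, h⟩, rfl⟩
      rw [h]
      exact ⟨⟨m, rfl⟩, rfl⟩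
  · intro z
    obtain ⟨γ, h⟩ := hex (-⌊z.1⌋)
    refine ⟨γ, ⟨_, h⟩, ?_⟩
    rw [h]
    exact ⟨rz_fract_mem _, trivial⟩
  · rintro γ ⟨m, h⟩ z hd
    rw [h, Prod.dist_eq, max_lt_iff] at hd
    simp only [Real.dist_eq, add_sub_cancel_left] at hd
    rw [h, rz_int_small hd.1]
    simp

theorem rz_klein_rel (p q : ℝ × ℝ) :
    Quot.mk (fun p q : ℝ × ℝ => q = (p.1 + 1, p.2) ∨ (q.1 = -p.1 ∧ q.2 = p.2 + 1)) p = Quot.mk _ q ↔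
      ∃ (m n : ℤ), q.1 = (((-1 : ℤˣ) ^ n : ℤˣ) : ℤ) * p.1 + m ∧ q.2 = p.2 + n := by
  constructor
  · intro h
    have := Quot.eqvGen_exact h
    clear h
    induction this with
    | rel x y h =>
      rcases h with rfl | ⟨h1, h2⟩
      · exact ⟨1, 0, by simp, by simp⟩
      · exact ⟨0, 1, by simp [h1], by simp [h2]⟩
    | refl x => exact ⟨0, 0, by simp, by simp⟩
    | symm x y _ ih =>
      obtain ⟨m, n, h1, h2⟩ := ih
      rw [h1, h2]
      rcases Int.units_eq_one_or ((-1 : ℤˣ) ^ n) with h | h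
      · exact ⟨-m, -n, by rw [zpow_neg, h]; simp, by simp⟩
      · exact ⟨m, -n, by rw [zpow_neg, h]; simp, by simp⟩
    | trans x y z _ _ ih1 ih2 =>
      obtain ⟨m, n, h1, h2⟩ := ih1
      obtain ⟨m', n', h3, h4⟩ := ih2
      refine ⟨(((-1 : ℤˣ) ^ n' : ℤˣ) : ℤ) * m + m', n + n', ?_, ?_⟩
      · rw [h3, h1, zpow_add]; push_cast; ring
      · rw [h4, h2]; push_cast; ring
  · rintro ⟨m, n, h1, h2⟩
    set R : ℝ × ℝ → ℝ × ℝ → Prop := fun p q => q = (p.1 + 1, p.2) ∨ (q.1 = -p.1 ∧ q.2 = p.2 + 1) with hR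
    have hm : ∀ (m : ℤ) (x y : ℝ), Quot.mk R (x + m, y) = Quot.mk R (x, y) := by
      intro m
      induction m with
      | zero => simp
      | succ k ih =>
        intro x y
        rw [← ih x y]
        refine Eq.symm (Quot.sound (Or.inl ?_))
        simp [add_assoc]
      | pred k ih =>
        intro x y
        rw [← ih x y]
        refine Quot.sound (Or.inl ?_)
        simp only [Prod.mk.injEq, and_true]
        push_cast; ring
    have hn : ∀ (n : ℤ) (x y : ℝ), Quot.mk R ((((-1 : ℤˣ) ^ n : ℤˣ) : ℤ) * x, y + n) = Quot.mk R (x, y) := by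
      intro n
      induction n with
      | zero => simp
      | succ k ih =>
        intro x y
        rw [← ih x y]
        refine Eq.symm (Quot.sound (Or.inr ⟨?_, ?_⟩))
        · simp only [zpow_add, zpow_one]; push_cast; ring
        · push_cast; ring
      | pred k ih =>
        intro x y
        rw [← ih x y]
        refine Quot.sound (Or.inr ⟨?_, ?_⟩)
        · simp only [zpow_sub, zpow_one, inv_neg, inv_one]; push_cast; ring
        · push_cast; ring
    have : q = (((((-1 : ℤˣ) ^ n : ℤˣ) : ℤ) : ℝ) * p.1 + m, p.2 + n) := Prod.ext h1 h2
    rw [this, hm, hn]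

theorem rz_klein {M : Type*} [MetricSpace M] (e : M ≃ₜ KleinBottle) (f : M ≃ₜ M)
    (hrec : IsRecurrent (f : M → M)) (hper : ∃ x₀, ∃ m ≥ 1, (f : M → M)^[m] x₀ = x₀) :
    ∃ n ≥ 1, ∀ x, (f : M → M)^[n] x = x := by
  have hex : ∀ m n : ℤ, ∃ γ : ℝ × ℝ ≃ᵢ ℝ × ℝ, ∀ z, γ z = ((((-1 : ℤˣ) ^ n : ℤˣ) : ℤ) * z.1 + m, z.2 + n) :=
    fun m n => by
    obtain ⟨g, hg⟩ := rz_iso_sign ((-1) ^ n) m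
    obtain ⟨γ, h⟩ := rz_iso_add g (IsometryEquiv.addRight (n : ℝ))
    exact ⟨γ, fun z => by rw [h, hg]; rfl⟩
  refine rz_quotient e (p₀ := Quot.mk _) isQuotientMap_quot_mk
    {γ | ∃ m n : ℤ, ∀ z, γ z = ((((-1 : ℤˣ) ^ n : ℤˣ) : ℤ) * z.1 + m, z.2 + n)} ?_
    (K := Set.Icc 0 1 ×ˢ Set.Icc 0 1) (isCompact_Icc.prod isCompact_Icc) ?_ (δ := 1/2) (by norm_num) ?_
    (δ0 := 1) one_pos (fun F => rz_planeR F) f hrec hper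
  · intro z w
    refine (rz_klein_rel z w).trans ?_
    constructor
    · rintro ⟨m, n, h1, h2⟩
      obtain ⟨γ, h⟩ := hex m n
      exact ⟨γ, ⟨m, n, h⟩, (h z).trans (Prod.ext h1.symm h2.symm)⟩
    · rintro ⟨γ, ⟨m, n, h⟩, rfl⟩
      rw [h]
      exact ⟨m, n, rfl, rfl⟩
  · intro z
    obtain ⟨γ, h⟩ := hex (-⌊(((((-1 : ℤˣ) ^ (-⌊z.2⌋) : ℤˣ) : ℤ) : ℝ) * z.1)⌋) (-⌊z.2⌋)
    refine ⟨γ, ⟨_, _, h⟩, ?_⟩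
    rw [h]
    exact ⟨rz_fract_mem _, rz_fract_mem _⟩
  · rintro γ ⟨m, n, h⟩ z hd
    rw [h, Prod.dist_eq, max_lt_iff] at hd
    simp only [Real.dist_eq, add_sub_cancel_left] at hd
    obtain rfl := rz_int_small hd.2
    have h1 := hd.1
    simp only [zpow_zero, Units.val_one, Int.cast_one, one_mul, add_sub_cancel_left] at h1
    rw [h, rz_int_small h1]
    simp

/-- The reflection of `[-1,1]`. -/
theorem rz_icc_sign (s : ℤˣ) : ∃ g : Set.Icc (-1:ℝ) 1 ≃ᵢ Set.Icc (-1:ℝ) 1, ∀ x, (g x : ℝ) = ((s : ℤ) : ℝ) * x := by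
  rcases Int.units_eq_one_or s with rfl | rfl
  · exact ⟨IsometryEquiv.refl _, fun x => by simp; rfl⟩
  · have hm : ∀ x : Set.Icc (-1:ℝ) 1, -(x:ℝ) ∈ Set.Icc (-1:ℝ) 1 := fun x =>
      ⟨by linarith [x.2.2], by linarith [x.2.1]⟩
    refine ⟨IsometryEquiv.mk' (fun x => ⟨-x, hm x⟩) (fun x => ⟨-x, hm x⟩) (fun x => by simp) ?_, fun x => ?_⟩
    swap
    · have h1 : (((-1 : ℤˣ) : ℤ) : ℝ) * (x : ℝ) = -(x : ℝ) := by simp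
      rw [h1]; rfl
    refine Isometry.of_dist_eq fun x y => ?_
    rw [Subtype.dist_eq, Subtype.dist_eq]
    exact dist_neg_neg _ _

theorem rz_moebius_rel (p q : ℝ × Set.Icc (-1:ℝ) 1) :
    Quot.mk (fun p q : ℝ × (Set.Icc (-1 : ℝ) 1) => q.1 = p.1 + 1 ∧ (q.2 : ℝ) = -(p.2 : ℝ)) p
      = Quot.mk _ q ↔
      ∃ (n : ℤ), q.1 = p.1 + n ∧ (q.2 : ℝ) = (((-1 : ℤˣ) ^ n : ℤˣ) : ℤ) * p.2 := by
  constructor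
  · intro h
    have := Quot.eqvGen_exact h
    clear h
    induction this with
    | rel x y h => exact ⟨1, by simp [h.1], by simp [h.2]⟩
    | refl x => exact ⟨0, by simp, by simp⟩
    | symm x y _ ih =>
      obtain ⟨n, h1, h2⟩ := ih
      refine ⟨-n, by rw [h1]; simp, ?_⟩
      rw [h2]
      rcases Int.units_eq_one_or ((-1 : ℤˣ) ^ n) with h | h
      · rw [zpow_neg, h]; simp
      · rw [zpow_neg, h]; simp
    | trans x y z _ _ ih1 ih2 =>
      obtain ⟨n, h1, h2⟩ := ih1
      obtain ⟨n', h3, h4⟩ := ih2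
      refine ⟨n + n', ?_, ?_⟩
      · rw [h3, h1]; push_cast; ring
      · rw [h4, h2, zpow_add]; push_cast; ring
  · rintro ⟨n, h1, h2⟩
    set R : ℝ × (Set.Icc (-1 : ℝ) 1) → ℝ × (Set.Icc (-1 : ℝ) 1) → Prop :=
      fun p q => q.1 = p.1 + 1 ∧ (q.2 : ℝ) = -(p.2 : ℝ) with hR
    have hn : ∀ (n : ℤ) (p q : ℝ × (Set.Icc (-1 : ℝ) 1)), q.1 = p.1 + n →
        (q.2 : ℝ) = (((-1 : ℤˣ) ^ n : ℤˣ) : ℤ) * p.2 → Quot.mk R p = Quot.mk R q := by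
      intro n
      induction n with
      | zero =>
        intro p q h1 h2
        exact congrArg _ (Prod.ext (by simp [h1]) (Subtype.ext (by simp [h2])))
      | succ k ih =>
        intro p q h1 h2
        obtain ⟨g, hg⟩ := rz_icc_sign (-1)
        have hs : Quot.mk R (q.1 - 1, g q.2) = Quot.mk R q := Quot.sound ⟨by simp, by rw [hg]; simp⟩
        rw [← hs]
        apply ih
        · simp only [h1]; push_cast; ring
        · rw [hg, h2, zpow_add]; push_cast; simp
      | pred k ih =>
        intro p q h1 h2
        obtain ⟨g, hg⟩ := rz_icc_sign (-1)
        have hs : Quot.mk R q = Quot.mk R (q.1 + 1, g q.2) := Quot.sound ⟨by simp, by rw [hg]; simp⟩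
        rw [hs]
        apply ih
        · simp only [h1]; push_cast; ring
        · rw [hg, h2, zpow_sub]; push_cast; simp
    exact hn n p q h1 h2

theorem rz_moebius {M : Type*} [MetricSpace M] (e : M ≃ₜ MoebiusBand) (f : M ≃ₜ M)
    (hrec : IsRecurrent (f : M → M)) (hper : ∃ x₀, ∃ m ≥ 1, (f : M → M)^[m] x₀ = x₀) :
    ∃ n ≥ 1, ∀ x, (f : M → M)^[n] x = x := by
  have hex : ∀ n : ℤ, ∃ γ : ℝ × Set.Icc (-1:ℝ) 1 ≃ᵢ ℝ × Set.Icc (-1:ℝ) 1,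
      ∀ z, (γ z).1 = z.1 + n ∧ ((γ z).2 : ℝ) = (((-1 : ℤˣ) ^ n : ℤˣ) : ℤ) * z.2 := fun n => by
    obtain ⟨g, hg⟩ := rz_icc_sign ((-1) ^ n)
    obtain ⟨γ, h⟩ := rz_iso_add (IsometryEquiv.addRight (n : ℝ)) g
    exact ⟨γ, fun z => by rw [h, hg]; exact ⟨rfl, rfl⟩⟩
  have : PreconnectedSpace (Set.Icc (-1:ℝ) 1) := isPreconnected_iff_preconnectedSpace.1 isPreconnected_Icc
  refine rz_quotient e (p₀ := Quot.mk _) isQuotientMap_quot_mk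
    {γ | ∃ n : ℤ, ∀ z, (γ z).1 = z.1 + n ∧ ((γ z).2 : ℝ) = (((-1 : ℤˣ) ^ n : ℤˣ) : ℤ) * z.2} ?_
    (K := Set.Icc 0 1 ×ˢ Set.univ) (isCompact_Icc.prod isCompact_univ) ?_ (δ := 1/2) (by norm_num) ?_
    (δ0 := 1 - (-1)) (by norm_num) (fun F => rz_strip (by norm_num) F) f hrec hper
  · intro z w
    refine (rz_moebius_rel z w).trans ?_
    constructor
    · rintro ⟨n, h1, h2⟩
      obtain ⟨γ, h⟩ := hex n
      exact ⟨γ, ⟨n, h⟩, Prod.ext ((h z).1.trans h1.symm) (Subtype.ext ((h z).2.trans h2.symm))⟩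
    · rintro ⟨γ, ⟨n, h⟩, rfl⟩
      exact ⟨n, h z⟩
  · intro z
    obtain ⟨γ, h⟩ := hex (-⌊z.1⌋)
    refine ⟨γ, ⟨_, h⟩, ?_, trivial⟩
    rw [(h z).1]
    exact rz_fract_mem _
  · rintro γ ⟨n, h⟩ z hd
    rw [Prod.dist_eq, max_lt_iff, (h z).1] at hd
    simp only [Real.dist_eq, add_sub_cancel_left] at hd
    obtain rfl := rz_int_small hd.1
    exact Prod.ext (by rw [(h z).1]; simp) (Subtype.ext (by rw [(h z).2]; simp))

/-- A recurrent homeomorphism of a compact surface of Euler characteristic zero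
(the torus, the Klein bottle, the annulus or the Moebius band) which has a
periodic point is periodic. -/
theorem euler_zero_recurrent_periodic_point
    {M : Type*} [MetricSpace M] [CompactSpace M]
    (hchi : Nonempty (M ≃ₜ Torus2) ∨ Nonempty (M ≃ₜ KleinBottle) ∨
      Nonempty (M ≃ₜ Annulus2) ∨ Nonempty (M ≃ₜ MoebiusBand))
    (f : M ≃ₜ M) (hrec : IsRecurrent (f : M → M))
    (hper : ∃ x₀, ∃ m ≥ 1, (f : M → M)^[m] x₀ = x₀) :
    ∃ n ≥ 1, ∀ x, (f : M → M)^[n] x = x := by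
  rcases hchi with ⟨⟨e⟩⟩ | ⟨⟨e⟩⟩ | ⟨⟨e⟩⟩ | ⟨⟨e⟩⟩
  · exact rz_torus e f hrec hper
  · exact rz_klein e f hrec hper
  · exact rz_annulus e f hrec hper
  · exact rz_moebius e f hrec hper
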